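/- arXiv:2308.10221 — 4 statements merged into one kernel-verified Lean document; each statement's English description precedes it below -/
import Mathlib

section
/- There exists a unique positive function g on (0,∞) such that r ↦ g'(r)/g(r) is continuously differentiable on (0,∞), (g'/g)'(r) + ((n-1)/r)·(g'(r)/g(r)) + α0·g(r) + β0·r·g'(r) = 0 for all r > 0, and lim_{r→0+} r^{α0/β0}·g(r) = η. -/
open Real Set Filter

/-- radially symmetric solution of `Δ log g + α0 g + β0 x·∇g = 0` on `(0,∞)`
with `lim_{r→0+} r^{α0/β0} g(r) = η`. -/
def LogSol (n : ℕ) (α0 β0 η : ℝ) (g : ℝ → ℝ) : Prop :=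
  (∀ r ∈ Set.Ioi (0 : ℝ), 0 < g r) ∧
  ContDiffOn ℝ 1 (fun r => deriv g r / g r) (Set.Ioi 0) ∧
  (∀ r ∈ Set.Ioi (0 : ℝ),
    deriv (fun r' => deriv g r' / g r') r
      + (((n : ℝ) - 1) / r) * (deriv g r / g r)
      + α0 * g r + β0 * r * deriv g r = 0) ∧
  Filter.Tendsto (fun r => r ^ (α0 / β0) * g r) (nhdsWithin 0 (Set.Ioi 0)) (nhds η)

/-- Exponential upper bound for the slope of a logarithmic profile. -/
noncomputable def slopeBound (K β b c s : ℝ) : ℝ := K / β * exp (b * s - c)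

/-- `v` solves `v'' + (m + β e^{v - b s}) v' = K` on `I` with slope `p = v'`, together with the a
priori bounds satisfied by solutions tending to `c` at `-∞`. -/
structure IsProfileOn (K m β b c : ℝ) (I : Set ℝ) (v p : ℝ → ℝ) : Prop where
  deriv_v : ∀ s ∈ I, HasDerivWithinAt v (p s) I s
  deriv_p : ∀ s ∈ I, HasDerivWithinAt p (K - (m + β * exp (v s - b * s)) * p s) I s
  p_nonneg : ∀ s ∈ I, 0 ≤ p s
  p_le : ∀ s ∈ I, p s ≤ slopeBound K β b c s
  le_v : ∀ s ∈ I, c ≤ v s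
  v_le : ∀ s ∈ I, v s ≤ c + slopeBound K β b c s / b

variable {K m β b c : ℝ}

lemma slopeBound_pos (hK : 0 < K) (hβ : 0 < β) (s : ℝ) : 0 < slopeBound K β b c s := by
  unfold slopeBound; positivity

lemma mul_slopeBound (hβ : β ≠ 0) (s : ℝ) :
    β * exp (c - b * s) * slopeBound K β b c s = K := by
  unfold slopeBound
  field_simp
  rw [mul_right_comm, ← exp_add]
  simp

lemma slopeBound_mono (hK : 0 < K) (hβ : 0 < β) (hb : 0 < b) :
    Monotone (slopeBound K β b c) := by
  intro s t hst
  unfold slopeBound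
  gcongr

lemma hasDerivAt_slopeBound (s : ℝ) :
    HasDerivAt (slopeBound K β b c) (b * slopeBound K β b c s) s := by
  unfold slopeBound
  have h : HasDerivAt (fun s => b * s - c) b s := by
    simpa using ((hasDerivAt_id s).const_mul b).sub_const c
  exact (h.exp.const_mul (K / β)).congr_deriv (by ring)

lemma slopeBound_tendsto_atBot (hb : 0 < b) :
    Tendsto (slopeBound K β b c) atBot (nhds 0) := by
  have h : Tendsto (fun s => b * s - c) atBot atBot :=
    tendsto_atBot_add_const_right _ _ (tendsto_id.const_mul_atBot hb)
  have h' := (tendsto_exp_atBot.comp h).const_mul (K / β)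
  rw [mul_zero] at h'
  exact h'

lemma IsProfileOn.mono {I J : Set ℝ} {v p : ℝ → ℝ} (h : IsProfileOn K m β b c I v p)
    (hJ : J ⊆ I) : IsProfileOn K m β b c J v p where
  deriv_v s hs := (h.deriv_v s (hJ hs)).mono hJ
  deriv_p s hs := (h.deriv_p s (hJ hs)).mono hJ
  p_nonneg s hs := h.p_nonneg s (hJ hs)
  p_le s hs := h.p_le s (hJ hs)
  le_v s hs := h.le_v s (hJ hs)
  v_le s hs := h.v_le s (hJ hs)

lemma abs_exp_sub_exp_le {x y z : ℝ} (hx : x ≤ z) (hy : y ≤ z) :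
    |exp x - exp y| ≤ exp z * |x - y| := by
  have key : ∀ x y : ℝ, y ≤ x → x ≤ z → |exp x - exp y| ≤ exp z * |x - y| := by
    intro x y hyx hxz
    rw [abs_of_nonneg (sub_nonneg.2 (exp_le_exp.2 hyx)), abs_of_nonneg (sub_nonneg.2 hyx)]
    have h1 : 1 - (x - y) ≤ exp (-(x - y)) := one_sub_le_exp_neg _
    have h2 : exp y = exp x * exp (-(x - y)) := by rw [← exp_add]; congr 1; ring
    have h3 : exp x ≤ exp z := exp_le_exp.2 hxz
    have h4 := exp_pos x
    nlinarith [mul_le_mul_of_nonneg_left h1 h4.le,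
      mul_le_mul_of_nonneg_right h3 (sub_nonneg.2 hyx)]
  rcases le_total y x with h | h
  · exact key x y h hx
  · rw [abs_sub_comm, abs_sub_comm x y]; exact key y x h hy

/-- The damping terms of two profiles differ, after multiplication by a slope, by at most a
constant times the distance of the profiles. -/
lemma abs_damping_sub_mul_le (hK : 0 < K) (hβ : 0 < β) (hb : 0 < b) {s S v₁ v₂ p₂ : ℝ}
    (hs : s ≤ S) (h₁ : v₁ ≤ c + slopeBound K β b c s / b)
    (h₂ : v₂ ≤ c + slopeBound K β b c s / b) (hp₀ : 0 ≤ p₂) (hp : p₂ ≤ slopeBound K β b c s) :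
    |((m + β * exp (v₁ - b * s)) - (m + β * exp (v₂ - b * s))) * p₂|
      ≤ K * exp (slopeBound K β b c S / b) * |v₁ - v₂| := by
  have hmono : slopeBound K β b c s / b ≤ slopeBound K β b c S / b := by
    gcongr; exact slopeBound_mono hK hβ hb hs
  have h := abs_exp_sub_exp_le (x := v₁ - b * s) (y := v₂ - b * s)
    (z := c + slopeBound K β b c S / b - b * s) (by linarith) (by linarith)
  rw [show v₁ - b * s - (v₂ - b * s) = v₁ - v₂ by ring] at h
  rw [show (m + β * exp (v₁ - b * s)) - (m + β * exp (v₂ - b * s))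
    = β * (exp (v₁ - b * s) - exp (v₂ - b * s)) by ring, abs_mul, abs_mul, abs_of_pos hβ,
    abs_of_nonneg hp₀]
  calc β * |exp (v₁ - b * s) - exp (v₂ - b * s)| * p₂
      ≤ β * (exp (c + slopeBound K β b c S / b - b * s) * |v₁ - v₂|) * slopeBound K β b c s := by
        gcongr
    _ = K * (exp (c + slopeBound K β b c S / b - b * s) * exp (b * s - c)) * |v₁ - v₂| := by
        rw [show slopeBound K β b c s = K / β * exp (b * s - c) from rfl]
        field_simp
    _ = _ := by rw [← exp_add]; ring_nf

lemma energy_deriv_le {κ L t h x d e : ℝ} (hκ : 0 < κ) (ht : 0 < t)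
    (hh : 1 ≤ κ * t * h) (hx : |x| ≤ L * |d|) :
    2 * d * e + κ * (2 * e * (-h * e - x)) ≤ (1 + κ ^ 2 * L ^ 2) * t * (d ^ 2 + κ * e ^ 2) := by
  have h1 : 2 * d * e * t ≤ t ^ 2 * d ^ 2 + e ^ 2 := by nlinarith [sq_nonneg (t * d - e)]
  have h2 : x ^ 2 ≤ L ^ 2 * d ^ 2 := by
    rw [← sq_abs x, ← sq_abs d, ← mul_pow]; gcongr
  have h3 : -(2 * κ * e * x * t) ≤ e ^ 2 + κ ^ 2 * t ^ 2 * (L ^ 2 * d ^ 2) := by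
    have := mul_le_mul_of_nonneg_left h2 (by positivity : 0 ≤ κ ^ 2 * t ^ 2)
    nlinarith [sq_nonneg (e + κ * t * x)]
  have h4 : e ^ 2 ≤ κ * t * h * e ^ 2 := le_mul_of_one_le_left (sq_nonneg e) hh
  have h5 : 0 ≤ (1 + κ ^ 2 * L ^ 2) * t ^ 2 * (κ * e ^ 2) := by positivity
  refine le_of_mul_le_mul_right ?_ ht
  nlinarith

/-- Two profiles on `[s₀, S]` are close to each other, up to a constant depending only on `S`, when
`s₀` is very negative. -/
lemma exists_profile_dist_le (hK : 0 < K) (hm : 0 ≤ m) (hβ : 0 < β) (hb : 0 < b) (S : ℝ) :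
    ∃ A : ℝ, 0 < A ∧ ∀ s₀ s : ℝ, s₀ ≤ s → s ≤ S → ∀ v₁ p₁ v₂ p₂ : ℝ → ℝ,
      IsProfileOn K m β b c (Icc s₀ S) v₁ p₁ → IsProfileOn K m β b c (Icc s₀ S) v₂ p₂ →
      |v₁ s - v₂ s| ≤ A * slopeBound K β b c s₀ ∧ |p₁ s - p₂ s| ≤ A * slopeBound K β b c s₀ := by
  set κ : ℝ := exp (-c) / β with hκdef
  have hκ : 0 < κ := by positivity
  set L : ℝ := K * exp (slopeBound K β b c S / b) with hL
  set C : ℝ := 1 + κ ^ 2 * L ^ 2 with hC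
  have hCpos : 0 < C := by positivity
  set G : ℝ := (1 / b ^ 2 + κ) * exp (C * exp (b * S) / b) with hG
  have hGpos : 0 < G := by positivity
  refine ⟨√G + √(G / κ), by positivity, ?_⟩
  intro s₀ s hs₀ hsS v₁ p₁ v₂ p₂ H₁ H₂
  set Q := slopeBound K β b c s₀ with hQ
  have hQpos : 0 < Q := slopeBound_pos hK hβ _
  have hanti : AntitoneOn (fun s => ((v₁ s - v₂ s) ^ 2 + κ * (p₁ s - p₂ s) ^ 2)
      * exp (-(C * exp (b * s) / b))) (Icc s₀ S) := by
    have hder : ∀ x ∈ Icc s₀ S, HasDerivWithinAt (fun s => ((v₁ s - v₂ s) ^ 2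
        + κ * (p₁ s - p₂ s) ^ 2) * exp (-(C * exp (b * s) / b)))
        ((2 * (v₁ x - v₂ x) * (p₁ x - p₂ x) + κ * (2 * (p₁ x - p₂ x) *
          (-(m + β * exp (v₁ x - b * x)) * (p₁ x - p₂ x) - ((m + β * exp (v₁ x - b * x))
            - (m + β * exp (v₂ x - b * x))) * p₂ x))
          - C * exp (b * x) * ((v₁ x - v₂ x) ^ 2 + κ * (p₁ x - p₂ x) ^ 2))
          * exp (-(C * exp (b * x) / b))) (Icc s₀ S) x := by
      intro x hx
      have hd := (H₁.deriv_v x hx).sub (H₂.deriv_v x hx)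
      have he := (H₁.deriv_p x hx).sub (H₂.deriv_p x hx)
      have hexp : HasDerivAt (fun s => exp (-(C * exp (b * s) / b)))
          (exp (-(C * exp (b * x) / b)) * (-(C * exp (b * x)))) x := by
        have h0 : HasDerivAt (fun s => b * s) b x := by
          simpa using (hasDerivAt_id x).const_mul b
        refine (((h0.exp.const_mul C).div_const b).neg).exp.congr_deriv ?_
        field_simp
        rfl
      refine (((hd.pow 2).add ((he.pow 2).const_mul κ)).mul hexp.hasDerivWithinAt).congr_deriv ?_
      simp only [Pi.sub_apply, Pi.add_apply, Pi.pow_apply]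
      push_cast
      ring
    refine antitoneOn_of_hasDerivWithinAt_nonpos (convex_Icc _ _)
      (fun x hx => (hder x hx).continuousWithinAt)
      (fun x hx => (hder x (interior_subset hx)).mono interior_subset) ?_
    intro x hx
    replace hx := interior_subset hx
    refine mul_nonpos_of_nonpos_of_nonneg ?_ (exp_pos _).le
    have hdamp := abs_damping_sub_mul_le (m := m) hK hβ hb hx.2 (H₁.v_le x hx) (H₂.v_le x hx)
      (H₂.p_nonneg x hx) (H₂.p_le x hx)
    have hh : 1 ≤ κ * exp (b * x) * (m + β * exp (v₁ x - b * x)) := by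
      have h1 : 1 ≤ exp (v₁ x - c) := one_le_exp (by linarith [H₁.le_v x hx])
      have h2 : κ * exp (b * x) * (β * exp (v₁ x - b * x)) = exp (v₁ x - c) := by
        rw [hκdef]
        field_simp
        rw [← exp_add, ← exp_add]
        ring_nf
      have h3 : 0 ≤ κ * exp (b * x) * m := by positivity
      linarith
    have := energy_deriv_le (e := p₁ x - p₂ x) hκ (exp_pos (b * x)) hh hdamp
    linarith
  have hE := hanti (left_mem_Icc.2 (hs₀.trans hsS)) ⟨hs₀, hsS⟩ hs₀
  simp only at hE
  have hm₀ : s₀ ∈ Icc s₀ S := left_mem_Icc.2 (hs₀.trans hsS)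
  have hd0 : (v₁ s₀ - v₂ s₀) ^ 2 ≤ 1 / b ^ 2 * Q ^ 2 := by
    have : |v₁ s₀ - v₂ s₀| ≤ Q / b := by
      rw [abs_le]
      constructor <;> linarith [H₁.le_v _ hm₀, H₂.le_v _ hm₀, H₁.v_le _ hm₀, H₂.v_le _ hm₀]
    rw [← sq_abs, show 1 / b ^ 2 * Q ^ 2 = (Q / b) ^ 2 by ring]
    gcongr
  have he0 : (p₁ s₀ - p₂ s₀) ^ 2 ≤ Q ^ 2 := by
    have : |p₁ s₀ - p₂ s₀| ≤ Q := by
      rw [abs_le]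
      constructor <;> linarith [H₁.p_nonneg _ hm₀, H₂.p_nonneg _ hm₀, H₁.p_le _ hm₀,
        H₂.p_le _ hm₀]
    rw [← sq_abs]
    gcongr
  have hEs : (v₁ s - v₂ s) ^ 2 + κ * (p₁ s - p₂ s) ^ 2 ≤ G * Q ^ 2 := by
    have h1 : exp (-(C * exp (b * s₀) / b)) ≤ 1 := exp_le_one_iff.2 (by
      have : 0 ≤ C * exp (b * s₀) / b := by positivity
      linarith)
    have h2 : ((v₁ s₀ - v₂ s₀) ^ 2 + κ * (p₁ s₀ - p₂ s₀) ^ 2) * exp (-(C * exp (b * s₀) / b))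
        ≤ (1 / b ^ 2 * Q ^ 2 + κ * Q ^ 2) * 1 := by gcongr
    have h3 : exp (C * exp (b * s) / b) ≤ exp (C * exp (b * S) / b) := by gcongr
    calc (v₁ s - v₂ s) ^ 2 + κ * (p₁ s - p₂ s) ^ 2
        = (((v₁ s - v₂ s) ^ 2 + κ * (p₁ s - p₂ s) ^ 2) * exp (-(C * exp (b * s) / b)))
          * exp (C * exp (b * s) / b) := by
          rw [mul_assoc, ← exp_add]; simp
      _ ≤ ((1 / b ^ 2 * Q ^ 2 + κ * Q ^ 2) * 1) * exp (C * exp (b * S) / b) := by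
          exact mul_le_mul (hE.trans h2) h3 (exp_pos _).le (by positivity)
      _ = G * Q ^ 2 := by rw [hG]; ring
  constructor
  · have h1 : (v₁ s - v₂ s) ^ 2 ≤ G * Q ^ 2 := by
      have : 0 ≤ κ * (p₁ s - p₂ s) ^ 2 := by positivity
      linarith
    have h2 := abs_le_sqrt h1
    rw [sqrt_mul hGpos.le, sqrt_sq hQpos.le] at h2
    have : 0 ≤ √(G / κ) * Q := by positivity
    linarith
  · have h1 : (p₁ s - p₂ s) ^ 2 ≤ G / κ * Q ^ 2 := by
      rw [div_mul_eq_mul_div, le_div_iff₀ hκ]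
      nlinarith [sq_nonneg (v₁ s - v₂ s)]
    have h2 := abs_le_sqrt h1
    rw [sqrt_mul (by positivity), sqrt_sq hQpos.le] at h2
    have : 0 ≤ √G * Q := by positivity
    linarith

/-- The profile equation with initial data `v = c`, `v' = 0` at `s₀` is solvable on `[s₀, S]`. -/
lemma exists_isProfileOn_Icc (hK : 0 < K) (hm : 0 ≤ m) (hβ : 0 < β) (hb : 0 < b) {s₀ S : ℝ}
    (hs : s₀ ≤ S) : ∃ v p : ℝ → ℝ, IsProfileOn K m β b c (Icc s₀ S) v p := by
  set A := slopeBound K β b c S with hA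
  have hApos : 0 < A := slopeBound_pos hK hβ S
  set V := c + A / b with hV
  have hcV : c ≤ V := by
    have : 0 ≤ A / b := by positivity
    linarith
  set H := m + β * exp (V - b * s₀) with hH
  have hHpos : 0 < H := by positivity
  let clip : ℝ → ℝ := fun y => max 0 (min y A)
  have clip0 : ∀ y, 0 ≤ clip y := fun y => le_max_left _ _
  have clipA : ∀ y, clip y ≤ A := fun y => max_le hApos.le (min_le_right _ _)
  have clip_lip : ∀ x y, |clip x - clip y| ≤ |x - y| := by
    intro x y
    have h1 : |clip x - clip y| ≤ |min x A - min y A| := by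
      simpa using abs_max_sub_max_le_max 0 (min x A) 0 (min y A)
    have h2 : |min x A - min y A| ≤ |x - y| := by
      simpa using abs_min_sub_min_le_max x A y A
    exact h1.trans h2
  let h : ℝ → ℝ → ℝ := fun s y => m + β * exp (min y V - b * s)
  have h_nonneg : ∀ s y, 0 ≤ h s y := fun s y => by positivity
  have h_le : ∀ s y, s₀ ≤ s → h s y ≤ H := by
    intro s y hs
    have : min y V - b * s ≤ V - b * s₀ := by
      have := mul_le_mul_of_nonneg_left hs hb.le
      linarith [min_le_right y V]
    simp only [h, hH]
    gcongr
  have h_lip : ∀ s x y, s₀ ≤ s → |h s x - h s y| ≤ H * |x - y| := by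
    intro s x y hs
    have hbs := mul_le_mul_of_nonneg_left hs hb.le
    have h1 := abs_exp_sub_exp_le (x := min x V - b * s) (y := min y V - b * s)
      (z := V - b * s₀) (by linarith [min_le_right x V]) (by linarith [min_le_right y V])
    have h2 : |min x V - b * s - (min y V - b * s)| ≤ |x - y| := by
      simpa using abs_min_sub_min_le_max x V y V
    have h3 : h s x - h s y = β * (exp (min x V - b * s) - exp (min y V - b * s)) := by
      simp only [h]; ring
    rw [h3, abs_mul, abs_of_pos hβ]
    calc β * |exp (min x V - b * s) - exp (min y V - b * s)|
        ≤ β * (exp (V - b * s₀) * |x - y|) := by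
          gcongr; exact h1.trans (by gcongr)
      _ ≤ H * |x - y| := by
          rw [← mul_assoc]
          gcongr
          linarith
  let f : ℝ → ℝ × ℝ → ℝ × ℝ := fun s x => (clip x.2, K - h s x.1 * clip x.2)
  let B : NNReal := ⟨A + K + H * A, by positivity⟩
  let Λ : NNReal := ⟨1 + H + H * A, by positivity⟩
  have hPL : IsPicardLindelof f (tmin := s₀) (tmax := S) ⟨s₀, left_mem_Icc.2 hs⟩ (c, 0)
      (B * ⟨S - s₀, sub_nonneg.2 hs⟩) 0 B Λ := by
    refine ⟨?_, ?_, ?_, ?_⟩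
    · intro s hs
      refine LipschitzOnWith.of_dist_le_mul fun x _ y _ => ?_
      have hx1 : |x.1 - y.1| ≤ dist x y := by
        rw [Prod.dist_eq, ← Real.dist_eq]; exact le_max_left _ _
      have hx2 : |x.2 - y.2| ≤ dist x y := by
        rw [Prod.dist_eq, ← Real.dist_eq x.2]; exact le_max_right _ _
      have hc := (clip_lip x.2 y.2).trans hx2
      have hh := h_lip s x.1 y.1 hs.1
      have hd : 0 ≤ dist x y := dist_nonneg
      have e1 : dist (f s x) (f s y) = max |clip x.2 - clip y.2|
          |(K - h s x.1 * clip x.2) - (K - h s y.1 * clip y.2)| := rfl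
      have e2 : (Λ : ℝ) = 1 + H + H * A := rfl
      rw [e1, e2]
      refine max_le ?_ ?_
      · nlinarith [mul_nonneg hHpos.le hd, mul_nonneg (mul_nonneg hHpos.le hApos.le) hd]
      · calc |(K - h s x.1 * clip x.2) - (K - h s y.1 * clip y.2)|
            = |-(h s x.1 * (clip x.2 - clip y.2)) - (h s x.1 - h s y.1) * clip y.2| := by
              congr 1; ring
          _ ≤ |-(h s x.1 * (clip x.2 - clip y.2))| + |(h s x.1 - h s y.1) * clip y.2| :=
              abs_sub _ _
          _ = h s x.1 * |clip x.2 - clip y.2| + |h s x.1 - h s y.1| * clip y.2 := by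
              rw [abs_neg, abs_mul, abs_mul, abs_of_nonneg (h_nonneg s x.1),
                abs_of_nonneg (clip0 y.2)]
          _ ≤ H * dist x y + H * dist x y * A := by
              gcongr
              · exact h_le s x.1 hs.1
              · exact hh.trans (by gcongr)
              · exact clipA _
          _ ≤ (1 + H + H * A) * dist x y := by nlinarith
    · intro x _
      refine Continuous.continuousOn ?_
      simp only [f, h]
      fun_prop
    · intro s hs x _
      have e2 : (B : ℝ) = A + K + H * A := rfl
      have e1 : ‖f s x‖ = max |clip x.2| |K - h s x.1 * clip x.2| := rfl
      have hhA : h s x.1 * clip x.2 ≤ H * A :=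
        mul_le_mul (h_le s _ hs.1) (clipA _) (clip0 _) hHpos.le
      have hh0 : 0 ≤ h s x.1 * clip x.2 := mul_nonneg (h_nonneg _ _) (clip0 _)
      have hHA : 0 ≤ H * A := by positivity
      rw [e1, e2]
      refine max_le ?_ ?_
      · rw [abs_of_nonneg (clip0 _)]; linarith [clipA x.2]
      · rw [abs_le]; constructor <;> linarith
    · simp only [sub_self, NNReal.coe_zero, sub_zero, max_eq_left (sub_nonneg.2 hs)]
      exact le_rfl
  obtain ⟨α, hα0, hα⟩ := hPL.exists_eq_forall_mem_Icc_hasDerivWithinAt₀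
  simp only at hα0
  have hv : ∀ s ∈ Icc s₀ S, HasDerivWithinAt (fun s => (α s).1) (clip (α s).2) (Icc s₀ S) s :=
    fun s hs => (hα s hs).fst
  have hp : ∀ s ∈ Icc s₀ S, HasDerivWithinAt (fun s => (α s).2)
      (K - h s (α s).1 * clip (α s).2) (Icc s₀ S) s :=
    fun s hs => (hα s hs).snd
  have toIci : ∀ {u : ℝ → ℝ} {u' x : ℝ}, x ∈ Ico s₀ S → HasDerivWithinAt u u' (Icc s₀ S) x →
      HasDerivWithinAt u u' (Ici x) x := fun hx hu =>
    (hu.mono (Icc_subset_Icc_left hx.1)).mono_of_mem_nhdsWithin (Icc_mem_nhdsGE hx.2)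
  have hcv : ContinuousOn (fun s => (α s).1) (Icc s₀ S) := fun s hs => (hv s hs).continuousWithinAt
  have hcp : ContinuousOn (fun s => (α s).2) (Icc s₀ S) := fun s hs => (hp s hs).continuousWithinAt
  have hv0 : (α s₀).1 = c := by rw [hα0]
  have hp0 : (α s₀).2 = 0 := by rw [hα0]
  have p_nonneg : ∀ s ∈ Icc s₀ S, 0 ≤ (α s).2 := by
    refine image_le_of_deriv_right_lt_deriv_boundary' (f := fun _ => 0) (f' := fun _ => 0)
      continuousOn_const (fun x _ => hasDerivWithinAt_const _ _ _) hp0.ge hcp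
      (fun x hx => toIci hx (hp x (Ico_subset_Icc_self hx))) ?_
    intro x _ hx
    have : clip (α x).2 = 0 := by simp [clip, ← hx, hApos.le]
    simp only [this]
    linarith
  have le_v : ∀ s ∈ Icc s₀ S, c ≤ (α s).1 := by
    have hmono : MonotoneOn (fun s => (α s).1) (Icc s₀ S) :=
      monotoneOn_of_hasDerivWithinAt_nonneg (convex_Icc _ _) hcv
        (fun x hx => (hv x (interior_subset hx)).mono interior_subset) (fun x _ => clip0 _)
    intro s hs'
    rw [← hv0]
    exact hmono (left_mem_Icc.2 hs) hs' hs'.1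
  have p_le : ∀ s ∈ Icc s₀ S, (α s).2 ≤ slopeBound K β b c s := by
    refine image_le_of_deriv_right_lt_deriv_boundary hcp
      (fun x hx => toIci hx (hp x (Ico_subset_Icc_self hx)))
      (hp0.trans_le (slopeBound_pos hK hβ _).le) hasDerivAt_slopeBound ?_
    intro x hx hxe
    have hQ := slopeBound_pos (b := b) (c := c) hK hβ x
    have hclip : clip (α x).2 = slopeBound K β b c x := by
      have := slopeBound_mono (c := c) hK hβ hb hx.2.le
      simp only [clip, hxe]
      rw [min_eq_left this, max_eq_right hQ.le]
    have hexp : exp (c - b * x) ≤ exp (min (α x).1 V - b * x) := by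
      have := le_min (le_v x (Ico_subset_Icc_self hx)) hcV
      gcongr
    have : K ≤ h x (α x).1 * slopeBound K β b c x := by
      calc K = β * exp (c - b * x) * slopeBound K β b c x := (mul_slopeBound hβ.ne' x).symm
        _ ≤ h x (α x).1 * slopeBound K β b c x := by
          gcongr
          simp only [h]
          nlinarith
    rw [hclip]
    have : 0 < b * slopeBound K β b c x := by positivity
    linarith
  have hclip : ∀ s ∈ Icc s₀ S, clip (α s).2 = (α s).2 := by
    intro s hs
    have := (p_le s hs).trans (slopeBound_mono hK hβ hb hs.2)
    simp only [clip]
    rw [min_eq_left this, max_eq_right (p_nonneg s hs)]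
  have v_le : ∀ s ∈ Icc s₀ S, (α s).1 ≤ c + slopeBound K β b c s / b := by
    refine image_le_of_deriv_right_le_deriv_boundary hcv
      (fun x hx => toIci hx (hv x (Ico_subset_Icc_self hx))) ?_
      (B' := fun x => slopeBound K β b c x) ?_ ?_ ?_
    · rw [hv0]
      have := slopeBound_pos (b := b) (c := c) hK hβ s₀
      have : 0 ≤ slopeBound K β b c s₀ / b := by positivity
      linarith
    · exact fun x _ => (((hasDerivAt_slopeBound x).div_const b).const_add
        c).continuousAt.continuousWithinAt
    · exact fun x _ => ((((hasDerivAt_slopeBound x).div_const b).const_add c).congr_deriv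
        (by field_simp)).hasDerivWithinAt
    · intro x hx
      rw [hclip x (Ico_subset_Icc_self hx)]
      exact p_le x (Ico_subset_Icc_self hx)
  refine ⟨fun s => (α s).1, fun s => (α s).2, ?_, ?_, p_nonneg, p_le, le_v, v_le⟩
  · intro s hs
    exact (hv s hs).congr_deriv (hclip s hs)
  · intro s hs
    refine (hp s hs).congr_deriv ?_
    have : (α s).1 ≤ V := (v_le s hs).trans (by
      have := slopeBound_mono (c := c) hK hβ hb hs.2
      simp only [hV, hA]
      gcongr)
    rw [hclip s hs]
    simp only [h]
    rw [min_eq_left this]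

lemma exists_tendsto_of_abs_sub_le {u δ : ℕ → ℝ} {N₀ : ℕ} (hδ : Tendsto δ atTop (nhds 0))
    (h : ∀ N M, N₀ ≤ N → N ≤ M → |u N - u M| ≤ δ N) : ∃ l, Tendsto u atTop (nhds l) := by
  refine cauchySeq_tendsto_of_complete (Metric.cauchySeq_iff'.2 fun ε hε => ?_)
  obtain ⟨N, hN, hN₀⟩ := ((hδ.eventually_lt_const hε).and (eventually_ge_atTop N₀)).exists
  refine ⟨N, fun M hM => ?_⟩
  rw [dist_comm, Real.dist_eq]
  exact (h N M hN₀ hM).trans_lt hN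

/-- There is a profile on the whole line. -/
lemma exists_isProfileOn_univ (c : ℝ) (hK : 0 < K) (hm : 0 ≤ m) (hβ : 0 < β) (hb : 0 < b) :
    ∃ v p : ℝ → ℝ, IsProfileOn K m β b c univ v p := by
  choose V P hVP using fun N : ℕ => exists_isProfileOn_Icc (c := c) hK hm hβ hb
    (s₀ := -(N : ℝ)) (S := N) (by have : (0 : ℝ) ≤ N := N.cast_nonneg; linarith)
  have hQ0 : Tendsto (fun N : ℕ => slopeBound K β b c (-(N : ℝ))) atTop (nhds 0) :=
    (slopeBound_tendsto_atBot hb).comp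
      (tendsto_neg_atTop_atBot.comp tendsto_natCast_atTop_atTop)
  have key : ∀ S : ℝ, ∃ A : ℝ, 0 < A ∧ ∀ N M : ℕ, S ≤ N → N ≤ M → ∀ s, |s| ≤ S →
      |V N s - V M s| ≤ A * slopeBound K β b c (-(N : ℝ)) ∧
      |P N s - P M s| ≤ A * slopeBound K β b c (-(N : ℝ)) := by
    intro S
    obtain ⟨A, hA, h⟩ := exists_profile_dist_le (c := c) hK hm hβ hb S
    refine ⟨A, hA, fun N M hSN hNM s hs => ?_⟩
    have hNM' : (N : ℝ) ≤ M := by exact_mod_cast hNM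
    rw [abs_le] at hs
    exact h _ s (by linarith) hs.2 _ _ _ _ ((hVP N).mono (Icc_subset_Icc_right hSN))
      ((hVP M).mono (Icc_subset_Icc (by linarith) (hSN.trans hNM')))
  have hlim : ∀ s : ℝ, (∃ l, Tendsto (fun N => V N s) atTop (nhds l)) ∧
      ∃ l, Tendsto (fun N => P N s) atTop (nhds l) := by
    intro s
    obtain ⟨A, -, h⟩ := key |s|
    have hδ : Tendsto (fun N : ℕ => A * slopeBound K β b c (-(N : ℝ))) atTop (nhds 0) := by
      simpa using hQ0.const_mul A
    have hle : ∀ N, ⌈|s|⌉₊ ≤ N → |s| ≤ N := fun N hN => Nat.ceil_le.1 hN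
    exact ⟨exists_tendsto_of_abs_sub_le hδ fun N M hN hM => (h N M (hle N hN) hM s le_rfl).1,
      exists_tendsto_of_abs_sub_le hδ fun N M hN hM => (h N M (hle N hN) hM s le_rfl).2⟩
  choose v hv using fun s => (hlim s).1
  choose p hp using fun s => (hlim s).2
  have hmem : ∀ s : ℝ, ∀ᶠ N : ℕ in atTop, s ∈ Icc (-(N : ℝ)) N := fun s => by
    filter_upwards [eventually_ge_atTop ⌈|s|⌉₊] with N hN
    exact abs_le.1 (Nat.ceil_le.1 hN)
  have p_nonneg : ∀ s, 0 ≤ p s := fun s =>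
    ge_of_tendsto (hp s) ((hmem s).mono fun N hN => (hVP N).p_nonneg s hN)
  have p_le : ∀ s, p s ≤ slopeBound K β b c s := fun s =>
    le_of_tendsto (hp s) ((hmem s).mono fun N hN => (hVP N).p_le s hN)
  have le_v : ∀ s, c ≤ v s := fun s =>
    ge_of_tendsto (hv s) ((hmem s).mono fun N hN => (hVP N).le_v s hN)
  have v_le : ∀ s, v s ≤ c + slopeBound K β b c s / b := fun s =>
    le_of_tendsto (hv s) ((hmem s).mono fun N hN => (hVP N).v_le s hN)
  have key' : ∀ S : ℝ, ∃ A : ℝ, 0 < A ∧ ∀ N : ℕ, S ≤ N → ∀ s, |s| ≤ S →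
      |V N s - v s| ≤ A * slopeBound K β b c (-(N : ℝ)) ∧
      |P N s - p s| ≤ A * slopeBound K β b c (-(N : ℝ)) := by
    intro S
    obtain ⟨A, hA, h⟩ := key S
    refine ⟨A, hA, fun N hN s hs => ⟨?_, ?_⟩⟩
    · refine le_of_tendsto ((tendsto_const_nhds.sub (hv s)).abs) ?_
      filter_upwards [eventually_ge_atTop N] with M hM using (h N M hN hM s hs).1
    · refine le_of_tendsto ((tendsto_const_nhds.sub (hp s)).abs) ?_
      filter_upwards [eventually_ge_atTop N] with M hM using (h N M hN hM s hs).2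
  have toAt : ∀ {u : ℝ → ℝ} {u' S x : ℝ} {N : ℕ}, S ≤ N → x ∈ Ioo (-S) S →
      HasDerivWithinAt u u' (Icc (-(N : ℝ)) N) x → HasDerivAt u u' x := fun hN hx hu =>
    hu.hasDerivAt (Icc_mem_nhds (by linarith [hx.1]) (by linarith [hx.2]))
  have memIcc : ∀ {S x : ℝ} {N : ℕ}, S ≤ N → x ∈ Ioo (-S) S → x ∈ Icc (-(N : ℝ)) N :=
    fun hN hx => ⟨by linarith [hx.1], by linarith [hx.2]⟩
  refine ⟨v, p, fun s _ => HasDerivAt.hasDerivWithinAt ?_,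
    fun s _ => HasDerivAt.hasDerivWithinAt ?_, fun s _ => p_nonneg s, fun s _ => p_le s,
    fun s _ => le_v s, fun s _ => v_le s⟩
  all_goals
    set S := |s| + 1 with hS
    have hsS : s ∈ Ioo (-S) S := abs_lt.1 (by linarith)
    obtain ⟨A, hA, h⟩ := key' S
    have hNS : ∀ᶠ N : ℕ in atTop, S ≤ N := by
      filter_upwards [eventually_ge_atTop ⌈S⌉₊] with N hN using Nat.ceil_le.1 hN
  · refine hasDerivAt_of_tendstoUniformlyOn (f := V) (f' := P) (l := atTop) isOpen_Ioo ?_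
      (hNS.mono fun N hN x hx => toAt hN hx ((hVP N).deriv_v x (memIcc hN hx)))
      (fun x _ => hv x) hsS
    rw [Metric.tendstoUniformlyOn_iff]
    intro ε hε
    have hδ : Tendsto (fun N : ℕ => A * slopeBound K β b c (-(N : ℝ))) atTop (nhds 0) := by
      simpa using hQ0.const_mul A
    filter_upwards [hNS, hδ.eventually_lt_const hε] with N hN hNε x hx
    rw [dist_comm, Real.dist_eq]
    exact (h N hN x (abs_lt.2 hx).le).2.trans_lt hNε
  · set L := K * exp (slopeBound K β b c S / b) with hL
    set H := m + β * exp (c + slopeBound K β b c S / b + b * S) with hH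
    refine hasDerivAt_of_tendstoUniformlyOn (f := P)
      (f' := fun N x => K - (m + β * exp (V N x - b * x)) * P N x)
      (g' := fun x => K - (m + β * exp (v x - b * x)) * p x) (l := atTop) isOpen_Ioo ?_
      (hNS.mono fun N hN x hx => toAt hN hx ((hVP N).deriv_p x (memIcc hN hx)))
      (fun x _ => hp x) hsS
    rw [Metric.tendstoUniformlyOn_iff]
    intro ε hε
    have hδ : Tendsto (fun N : ℕ => (H + L) * (A * slopeBound K β b c (-(N : ℝ)))) atTop
        (nhds 0) := by
      simpa using (hQ0.const_mul A).const_mul (H + L)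
    filter_upwards [hNS, hδ.eventually_lt_const hε] with N hN hNε x hx
    obtain ⟨hdv, hdp⟩ := h N hN x (abs_lt.2 hx).le
    rw [dist_comm, Real.dist_eq]
    refine lt_of_le_of_lt ?_ hNε
    have hdamp := abs_damping_sub_mul_le (m := m) hK hβ hb hx.2.le
      ((hVP N).v_le x (memIcc hN hx)) (v_le x) (p_nonneg x) (p_le x)
    have hVH : m + β * exp (V N x - b * x) ≤ H := by
      have h1 := (hVP N).v_le x (memIcc hN hx)
      have h2 : slopeBound K β b c x / b ≤ slopeBound K β b c S / b := by
        gcongr; exact slopeBound_mono hK hβ hb hx.2.le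
      have h3 := mul_le_mul_of_nonneg_left hx.1.le hb.le
      have h4 : V N x - b * x ≤ c + slopeBound K β b c S / b + b * S := by linarith
      simp only [hH]
      gcongr
    have hV0 : 0 ≤ m + β * exp (V N x - b * x) := by positivity
    calc |K - (m + β * exp (V N x - b * x)) * P N x - (K - (m + β * exp (v x - b * x)) * p x)|
        = |-((m + β * exp (V N x - b * x)) * (P N x - p x))
            - (m + β * exp (V N x - b * x) - (m + β * exp (v x - b * x))) * p x| := by
          congr 1; ring
      _ ≤ |-((m + β * exp (V N x - b * x)) * (P N x - p x))|
            + |(m + β * exp (V N x - b * x) - (m + β * exp (v x - b * x))) * p x| := abs_sub _ _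
      _ ≤ H * (A * slopeBound K β b c (-(N : ℝ))) + L * (A * slopeBound K β b c (-(N : ℝ))) := by
          rw [abs_neg, abs_mul, abs_of_nonneg hV0]
          have hLpos : 0 < L := by positivity
          gcongr
          exact hdamp.trans (by gcongr)
      _ = _ := by ring

/-- A profile on the whole line is unique. -/
lemma IsProfileOn.eq_of_univ (hK : 0 < K) (hm : 0 ≤ m) (hβ : 0 < β) (hb : 0 < b)
    {v₁ p₁ v₂ p₂ : ℝ → ℝ} (h₁ : IsProfileOn K m β b c univ v₁ p₁)
    (h₂ : IsProfileOn K m β b c univ v₂ p₂) (s : ℝ) : v₁ s = v₂ s := by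
  obtain ⟨A, -, h⟩ := exists_profile_dist_le (c := c) hK hm hβ hb s
  have hlim : Tendsto (fun s₀ => A * slopeBound K β b c s₀) atBot (nhds 0) := by
    simpa using (slopeBound_tendsto_atBot hb).const_mul A
  have hle : |v₁ s - v₂ s| ≤ 0 := by
    refine ge_of_tendsto hlim ?_
    filter_upwards [eventually_le_atBot s] with s₀ hs₀
    exact (h s₀ s hs₀ le_rfl _ _ _ _ (h₁.mono (subset_univ _)) (h₂.mono (subset_univ _))).1
  exact sub_eq_zero.1 (abs_eq_zero.1 (le_antisymm hle (abs_nonneg _)))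

/-- If the derivative of `v` is bounded below by a positive constant on a left half-line, then `v`
has no finite limit at `-∞`. -/
lemma not_tendsto_atBot_of_le_deriv {v p : ℝ → ℝ} {l δ s₁ : ℝ} (hδ : 0 < δ)
    (hv : ∀ s, HasDerivAt v (p s) s) (hp : ∀ s ≤ s₁, δ ≤ p s) :
    ¬ Tendsto v atBot (nhds l) := by
  intro hlim
  have hmono : MonotoneOn (fun s => v s - δ * s) (Iic s₁) := by
    have hd : ∀ s, HasDerivAt (fun s => v s - δ * s) (p s - δ) s := fun s =>
      ((hv s).sub ((hasDerivAt_id s).const_mul δ)).congr_deriv (by simp)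
    refine monotoneOn_of_hasDerivWithinAt_nonneg (convex_Iic _)
      (fun s _ => (hd s).continuousAt.continuousWithinAt)
      (fun s _ => (hd s).hasDerivWithinAt) (fun s hs => ?_)
    exact sub_nonneg.2 (hp s (mem_Iic.1 (interior_subset hs)))
  have h1 : Tendsto (fun s => δ * s + (v s₁ - δ * s₁)) atBot atBot :=
    tendsto_atBot_add_const_right _ _ (tendsto_id.const_mul_atBot hδ)
  have h2 : Tendsto v atBot atBot := by
    refine tendsto_atBot_mono' _ ?_ h1
    filter_upwards [eventually_le_atBot s₁] with s hs
    have := hmono hs (mem_Iic.2 le_rfl) hs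
    simp only at this
    linarith
  exact not_tendsto_nhds_of_tendsto_atBot h2 l hlim

/-- A solution of the profile equation with limit `c` at `-∞` satisfies the a priori bounds. -/
lemma isProfileOn_univ_of_tendsto (hK : 0 < K) (hm : 0 ≤ m) (hβ : 0 < β) (hb : 0 < b)
    {v p : ℝ → ℝ} (hv : ∀ s, HasDerivAt v (p s) s)
    (hp : ∀ s, HasDerivAt p (K - (m + β * exp (v s - b * s)) * p s) s)
    (hlim : Tendsto v atBot (nhds c)) : IsProfileOn K m β b c univ v p := by
  have hcp : Continuous p := continuous_iff_continuousAt.2 fun s => (hp s).continuousAt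
  have p_nonneg : ∀ s, 0 ≤ p s := by
    by_contra! hneg
    obtain ⟨s₁, hs₁⟩ := hneg
    have hle : ∀ s ≤ s₁, p s ≤ p s₁ := by
      intro s hs
      by_contra! hlt
      have := image_le_of_deriv_right_lt_deriv_boundary' (f := fun _ => p s₁ + min (p s - p s₁)
        (-p s₁)) (f' := fun _ => 0) (a := s) (b := s₁) continuousOn_const
        (fun x _ => hasDerivWithinAt_const _ _ _)
        (by linarith [min_le_left (p s - p s₁) (-p s₁)]) hcp.continuousOn
        (fun x _ => (hp x).hasDerivWithinAt) ?_ (right_mem_Icc.2 hs)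
      · have h2 : 0 < min (p s - p s₁) (-p s₁) := lt_min (by linarith) (by linarith)
        linarith
      · intro x _ hx
        have : p x ≤ 0 := by rw [← hx]; linarith [min_le_right (p s - p s₁) (-p s₁)]
        have : (m + β * exp (v x - b * x)) * p x ≤ 0 :=
          mul_nonpos_of_nonneg_of_nonpos (by positivity) this
        linarith
    refine not_tendsto_atBot_of_le_deriv (v := fun s => -v s) (p := fun s => -p s) (l := -c)
      (neg_pos.2 hs₁) (fun s => (hv s).neg) (fun s hs => neg_le_neg (hle s hs)) hlim.neg
  have hvmono : Monotone v := monotone_of_hasDerivAt_nonneg hv p_nonneg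
  have le_v : ∀ s, c ≤ v s := fun s =>
    le_of_tendsto hlim ((eventually_le_atBot s).mono fun x hx => hvmono hx)
  have p_le : ∀ s, p s ≤ slopeBound K β b c s := by
    by_contra! hgt
    obtain ⟨s₁, hs₁⟩ := hgt
    set δ := p s₁ - slopeBound K β b c s₁ with hδ
    have hδpos : 0 < δ := sub_pos.2 hs₁
    have hle : ∀ s ≤ s₁, δ / 2 ≤ p s - slopeBound K β b c s := by
      intro s hs
      by_contra! hlt
      have hB : ∀ x, HasDerivAt (fun x => slopeBound K β b c x + δ / 2)
          (b * slopeBound K β b c x) x := fun x => (hasDerivAt_slopeBound x).add_const _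
      have := image_le_of_deriv_right_lt_deriv_boundary (a := s) (b := s₁) hcp.continuousOn
        (fun x _ => (hp x).hasDerivWithinAt) (by linarith) hB ?_ (right_mem_Icc.2 hs)
      · linarith
      · intro x _ hx
        have hQ := slopeBound_pos (b := b) (c := c) hK hβ x
        have hpx : slopeBound K β b c x ≤ p x := by linarith
        have hexp : exp (c - b * x) ≤ exp (v x - b * x) := by
          have := le_v x
          gcongr
        have h1 : β * exp (c - b * x) ≤ m + β * exp (v x - b * x) := by nlinarith
        have h2 : K ≤ (m + β * exp (v x - b * x)) * p x := by
          calc K = β * exp (c - b * x) * slopeBound K β b c x := (mul_slopeBound hβ.ne' x).symm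
            _ ≤ _ := mul_le_mul h1 hpx hQ.le (by positivity)
        have : 0 < b * slopeBound K β b c x := by positivity
        linarith
    refine not_tendsto_atBot_of_le_deriv (s₁ := s₁) (half_pos hδpos) hv (fun s hs => ?_) hlim
    have := slopeBound_pos (b := b) (c := c) hK hβ s
    linarith [hle s hs]
  have v_le : ∀ s, v s ≤ c + slopeBound K β b c s / b := by
    intro s
    have hd : ∀ x, HasDerivAt (fun x => slopeBound K β b c x / b - v x)
        (slopeBound K β b c x - p x) x := fun x =>
      (((hasDerivAt_slopeBound x).div_const b).sub (hv x)).congr_deriv (by field_simp)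
    have hmono := monotone_of_hasDerivAt_nonneg hd (fun x => sub_nonneg.2 (p_le x))
    have hl : Tendsto (fun x => slopeBound K β b c x / b - v x) atBot (nhds (0 / b - c)) :=
      ((slopeBound_tendsto_atBot hb).div_const b).sub hlim
    have := le_of_tendsto hl ((eventually_le_atBot s).mono fun x hx => hmono hx)
    simp only [zero_div] at this
    linarith
  exact ⟨fun s _ => (hv s).hasDerivWithinAt, fun s _ => (hp s).hasDerivWithinAt,
    fun s _ => p_nonneg s, fun s _ => p_le s, fun s _ => le_v s, fun s _ => v_le s⟩

/-- A profile on the whole line yields a solution of the radial equation. -/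
lemma logSol_of_isProfileOn {n : ℕ} {α₀ β₀ η a : ℝ} (hβ : 0 < β₀) (hη : 0 < η)
    (ha : a = α₀ / β₀) (ha2 : 2 < a) {v p : ℝ → ℝ}
    (h : IsProfileOn (((n : ℝ) - 2) * a) ((n : ℝ) - 2) β₀ (a - 2) (log η) univ v p) :
    LogSol n α₀ β₀ η (fun r => exp (v (log r) - a * log r)) := by
  have hv : ∀ s, HasDerivAt v (p s) s := fun s =>
    hasDerivWithinAt_univ.1 (h.deriv_v s (mem_univ s))
  have hp := fun s => hasDerivWithinAt_univ.1 (h.deriv_p s (mem_univ s))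
  have hcv : Continuous v := continuous_iff_continuousAt.2 fun s => (hv s).continuousAt
  have hcp : Continuous p := continuous_iff_continuousAt.2 fun s => (hp s).continuousAt
  set g : ℝ → ℝ := fun r => exp (v (log r) - a * log r) with hg
  have hgpos : ∀ r, 0 < g r := fun r => exp_pos _
  have hgd : ∀ r, 0 < r → HasDerivAt g (g r * ((p (log r) - a) / r)) r := by
    intro r hr
    have hl := hasDerivAt_log hr.ne'
    refine ((((hv (log r)).comp r hl).sub (hl.const_mul a)).exp).congr_deriv ?_
    simp only [hg, Function.comp, Pi.sub_apply]
    field_simp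
  have hq : ∀ r, 0 < r → deriv g r / g r = (p (log r) - a) / r := by
    intro r hr
    rw [(hgd r hr).deriv, mul_div_cancel_left₀ _ (hgpos r).ne']
  set F : ℝ → ℝ := fun r => ((((n : ℝ) - 2) * a - (((n : ℝ) - 2)
    + β₀ * exp (v (log r) - (a - 2) * log r)) * p (log r)) - (p (log r) - a)) / r ^ 2 with hF
  have hqd : ∀ r, 0 < r → HasDerivAt (fun r => deriv g r / g r) (F r) r := by
    intro r hr
    have hl := hasDerivAt_log hr.ne'
    have h1 := ((((hp (log r)).comp r hl).sub_const a).div (hasDerivAt_id r) hr.ne')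
    refine (h1.congr_of_eventuallyEq ?_).congr_deriv ?_
    · filter_upwards [Ioi_mem_nhds hr] with x hx using hq x hx
    · simp only [hF, Function.comp, id]
      field_simp
  refine ⟨fun r _ => hgpos r, ?_, ?_, ?_⟩
  · have hdo : DifferentiableOn ℝ (fun r => deriv g r / g r) (Ioi 0) := fun r hr =>
      (hqd r hr).differentiableAt.differentiableWithinAt
    rw [show (1 : WithTop ℕ∞) = 0 + 1 from rfl, contDiffOn_succ_iff_deriv_of_isOpen isOpen_Ioi]
    refine ⟨hdo, by simp, ?_⟩
    rw [contDiffOn_zero]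
    have hFc : ContinuousOn F (Ioi 0) := by
      have hlc : ContinuousOn log (Ioi 0) := continuousOn_log.mono fun x hx => ne_of_gt hx
      have hpl : ContinuousOn (fun r => p (log r)) (Ioi 0) := hcp.comp_continuousOn hlc
      have hvl : ContinuousOn (fun r => v (log r)) (Ioi 0) := hcv.comp_continuousOn hlc
      refine ContinuousOn.div ?_ (by fun_prop) fun x hx => pow_ne_zero 2 (ne_of_gt hx)
      fun_prop
    exact hFc.congr fun r hr => (hqd r hr).deriv
  · intro r hr
    have hr' : (0 : ℝ) < r := hr
    rw [(hqd r hr).deriv, hq r hr, (hgd r hr).deriv]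
    have hα : α₀ = a * β₀ := by rw [ha]; field_simp
    have hgr : exp (v (log r) - (a - 2) * log r) = r ^ 2 * g r := by
      rw [hg, show v (log r) - (a - 2) * log r = (log r + log r) + (v (log r) - a * log r) by ring,
        exp_add, exp_add, exp_log hr']
      ring
    simp only [hF, hgr, hα]
    field_simp
    ring
  · have hlim : Tendsto v atBot (nhds (log η)) := by
      have hup : Tendsto (fun s => log η + slopeBound (((n : ℝ) - 2) * a) β₀ (a - 2) (log η) s
          / (a - 2)) atBot (nhds (log η + 0 / (a - 2))) :=
        ((slopeBound_tendsto_atBot (sub_pos.2 ha2)).div_const _).const_add _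
      rw [zero_div, add_zero] at hup
      exact tendsto_of_tendsto_of_tendsto_of_le_of_le tendsto_const_nhds hup
        (fun s => h.le_v s (mem_univ s)) (fun s => h.v_le s (mem_univ s))
    have h2 : Tendsto (fun r => exp (v (log r))) (nhdsWithin 0 (Ioi 0)) (nhds η) := by
      have := (continuous_exp.tendsto (log η)).comp (hlim.comp tendsto_log_nhdsGT_zero)
      rwa [exp_log hη] at this
    refine h2.congr' ?_
    filter_upwards [self_mem_nhdsWithin] with r hr
    rw [rpow_def_of_pos hr, ← exp_add, ← ha]
    congr 1
    ring

/-- A solution in the sense of `LogSol` is differentiable, although `LogSol` only constrains the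
(totalized) derivative of `g`. -/
lemma LogSol.hasDerivAt {n : ℕ} {α₀ β₀ η : ℝ} {g : ℝ → ℝ} (hα : 0 < α₀)
    (h : LogSol n α₀ β₀ η g) {r : ℝ} (hr : 0 < r) : HasDerivAt g (deriv g r) r := by
  obtain ⟨hpos, hC, heq, -⟩ := h
  set q : ℝ → ℝ := fun r => deriv g r / g r with hq
  by_cases hd : deriv g r = 0
  swap
  · exact (differentiableAt_of_deriv_ne_zero hd).hasDerivAt
  have hqr : q r = 0 := by simp [hq, hd]
  have hCr : ContDiffAt ℝ 1 q r := hC.contDiffAt (Ioi_mem_nhds hr)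
  have hqd : HasDerivAt q (deriv q r) r := (hCr.differentiableAt one_ne_zero).hasDerivAt
  have hq' : deriv q r ≠ 0 := by
    have h1 := heq r hr
    rw [hd] at h1
    have h2 : 0 < α₀ * g r := mul_pos hα (hpos r hr)
    intro h0
    rw [h0] at h1
    simp only [zero_div, mul_zero, add_zero, zero_add] at h1
    exact h2.ne' h1
  have hcq : ContinuousAt q r := hqd.continuousAt
  have hcq' : ContinuousAt (deriv q) r := by
    have hC' := (contDiffOn_succ_iff_deriv_of_isOpen (n := 0) isOpen_Ioi).1 hC
    exact (contDiffOn_zero.1 hC'.2.2).continuousAt (Ioi_mem_nhds hr)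
  have hdenom : ContinuousAt (fun x => α₀ + β₀ * x * q x) r := by fun_prop
  have hdenom0 : α₀ + β₀ * r * q r ≠ 0 := by simp [hqr, hα.ne']
  have hgc : ContinuousAt g r := by
    have hrep : g =ᶠ[nhds r] fun x =>
        -(deriv q x + ((n : ℝ) - 1) / x * q x) / (α₀ + β₀ * x * q x) := by
      filter_upwards [hdenom.eventually_ne hdenom0, Ioi_mem_nhds hr] with x hx hx0
      rw [eq_div_iff hx]
      have h1 := heq x hx0
      have h2 : deriv g x = q x * g x := by
        simp only [hq]; rw [div_mul_cancel₀ _ (hpos x hx0).ne']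
      change deriv q x + ((n : ℝ) - 1) / x * q x + α₀ * g x + β₀ * x * deriv g x = 0 at h1
      rw [h2] at h1
      linarith
    refine ContinuousAt.congr ?_ hrep.symm
    refine ContinuousAt.div ?_ hdenom hdenom0
    have : ContinuousAt (fun x : ℝ => ((n : ℝ) - 1) / x) r :=
      continuousAt_const.div continuousAt_id hr.ne'
    exact (hcq'.add (this.mul hcq)).neg
  have hne : ∀ᶠ x in nhdsWithin r {r}ᶜ, q x ≠ 0 := hqd.eventually_ne hq'
  rw [eventually_nhdsWithin_iff] at hne
  obtain ⟨ε, hε, hball⟩ := Metric.eventually_nhds_iff.1 (hne.and (Ioi_mem_nhds hr))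
  have hdiff : ∀ x, dist x r < ε → x ≠ r → HasDerivAt g (q x * g x) x := by
    intro x hx hxr
    obtain ⟨h1, h2⟩ := hball hx
    have hdx : deriv g x ≠ 0 := fun h0 => h1 hxr (by simp [hq, h0])
    refine (differentiableAt_of_deriv_ne_zero hdx).hasDerivAt.congr_deriv ?_
    simp only [hq]
    rw [div_mul_cancel₀ _ (hpos x h2).ne']
  have hlim : ContinuousAt (fun x => q x * g x) r := hcq.mul hgc
  have hR : HasDerivWithinAt g (q r * g r) (Ici r) r := by
    refine hasDerivWithinAt_Ici_of_tendsto_deriv (s := Ioo r (r + ε)) (fun x hx => ?_)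
      hgc.continuousWithinAt (Ioo_mem_nhdsGT (by linarith)) ?_
    · refine (hdiff x ?_ (ne_of_gt hx.1)).differentiableAt.differentiableWithinAt
      rw [Real.dist_eq, abs_lt]
      constructor <;> linarith [hx.1, hx.2]
    · refine (hlim.tendsto.mono_left nhdsWithin_le_nhds).congr' ?_
      filter_upwards [Ioo_mem_nhdsGT (show r < r + ε by linarith)] with x hx
      refine (hdiff x ?_ (ne_of_gt hx.1)).deriv.symm
      rw [Real.dist_eq, abs_lt]
      constructor <;> linarith [hx.1, hx.2]
  have hL : HasDerivWithinAt g (q r * g r) (Iic r) r := by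
    refine hasDerivWithinAt_Iic_of_tendsto_deriv (s := Ioo (r - ε) r) (fun x hx => ?_)
      hgc.continuousWithinAt (Ioo_mem_nhdsLT (by linarith)) ?_
    · refine (hdiff x ?_ (ne_of_lt hx.2)).differentiableAt.differentiableWithinAt
      rw [Real.dist_eq, abs_lt]
      constructor <;> linarith [hx.1, hx.2]
    · refine (hlim.tendsto.mono_left nhdsWithin_le_nhds).congr' ?_
      filter_upwards [Ioo_mem_nhdsLT (show r - ε < r by linarith)] with x hx
      refine (hdiff x ?_ (ne_of_lt hx.2)).deriv.symm
      rw [Real.dist_eq, abs_lt]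
      constructor <;> linarith [hx.1, hx.2]
  have hder : HasDerivAt g (q r * g r) r := by simpa using hL.union hR
  exact hder.differentiableAt.hasDerivAt

/-- The logarithmic profile of a solution of the radial equation. -/
lemma LogSol.isProfileOn {n : ℕ} {α₀ β₀ η a : ℝ} {g : ℝ → ℝ} (hn : 3 ≤ n) (hα : 0 < α₀)
    (hβ : 0 < β₀) (hη : 0 < η) (ha : a = α₀ / β₀) (ha2 : 2 < a) (h : LogSol n α₀ β₀ η g) :
    IsProfileOn (((n : ℝ) - 2) * a) ((n : ℝ) - 2) β₀ (a - 2) (log η) univ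
      (fun s => log (g (exp s)) + a * s) (fun s => exp s * (deriv g (exp s) / g (exp s)) + a) := by
  have hgd := fun s => h.hasDerivAt hα (exp_pos s)
  obtain ⟨hpos, hC, heq, hlim⟩ := h
  have hn' : (3 : ℝ) ≤ n := by exact_mod_cast hn
  have hm : 0 < (n : ℝ) - 2 := by linarith
  have hαa : α₀ = a * β₀ := by rw [ha]; field_simp
  refine isProfileOn_univ_of_tendsto (mul_pos hm (by linarith)) hm.le hβ (by linarith) ?_ ?_ ?_
  · intro s
    have h1 := ((hgd s).comp s (hasDerivAt_exp s)).log (hpos _ (exp_pos s)).ne'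
    refine (h1.add ((hasDerivAt_id s).const_mul a)).congr_deriv ?_
    simp only [Function.comp]
    ring
  · intro s
    have hr := exp_pos s
    have hqd : HasDerivAt (fun r => deriv g r / g r) (deriv (fun r => deriv g r / g r) (exp s))
        (exp s) :=
      ((hC.contDiffAt (Ioi_mem_nhds hr)).differentiableAt one_ne_zero).hasDerivAt
    refine (((hasDerivAt_exp s).mul (hqd.comp s (hasDerivAt_exp s))).add_const a).congr_deriv ?_
    have hE := heq (exp s) hr
    have hgpos := hpos (exp s) hr
    have hgr : exp (log (g (exp s)) + a * s - (a - 2) * s) = exp s ^ 2 * g (exp s) := by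
      rw [show log (g (exp s)) + a * s - (a - 2) * s = (s + s) + log (g (exp s)) by ring,
        exp_add, exp_add, exp_log hgpos]
      ring
    simp only [Function.comp]
    rw [hgr]
    set D := deriv (fun r => deriv g r / g r) (exp s)
    have hq : deriv g (exp s) = deriv g (exp s) / g (exp s) * g (exp s) := by
      rw [div_mul_cancel₀ _ hgpos.ne']
    generalize deriv g (exp s) / g (exp s) = Q at *
    rw [hq] at hE
    generalize g (exp s) = G at *
    generalize exp s = r at *
    have hD : D = -(((n : ℝ) - 1) / r * Q + α₀ * G + β₀ * r * (Q * G)) := by linarith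
    rw [hD, hαa]
    field_simp
    ring
  · have h1 := (continuousAt_log hη.ne').tendsto.comp (hlim.comp tendsto_exp_atBot_nhdsGT)
    refine h1.congr fun s => ?_
    have hgpos := hpos (exp s) (exp_pos s)
    simp only [Function.comp]
    rw [log_mul (rpow_pos_of_pos (exp_pos s) _).ne' hgpos.ne', log_rpow (exp_pos s), log_exp,
      ← ha]
    ring

theorem stmt3 (n : ℕ) (η ρ1 β0 α0 : ℝ)
    (hn : 3 ≤ n) (hη : 0 < η) (hρ1 : 0 < ρ1) (hβ0 : 0 < β0)
    (hα0 : α0 = 2 * β0 + ρ1) :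
    ∃ g : ℝ → ℝ, LogSol n α0 β0 η g ∧
      ∀ g' : ℝ → ℝ, LogSol n α0 β0 η g' → Set.EqOn g' g (Set.Ioi 0) := by
  have hα : 0 < α0 := by rw [hα0]; positivity
  obtain ⟨a, ha⟩ : ∃ a, a = α0 / β0 := ⟨_, rfl⟩
  have ha2 : 2 < a := by rw [ha, lt_div_iff₀ hβ0]; linarith
  have hn' : (3 : ℝ) ≤ n := by exact_mod_cast hn
  have hm : 0 < (n : ℝ) - 2 := by linarith
  have hK : 0 < ((n : ℝ) - 2) * a := mul_pos hm (by linarith)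
  obtain ⟨v, p, hvp⟩ := exists_isProfileOn_univ (log η) hK hm.le hβ0 (sub_pos.2 ha2)
  refine ⟨_, logSol_of_isProfileOn hβ0 hη ha ha2 hvp, fun g' hg' r hr => ?_⟩
  have hr' : (0 : ℝ) < r := hr
  have h := (hg'.isProfileOn hn hα hβ0 hη ha ha2).eq_of_univ hK hm.le hβ0 (sub_pos.2 ha2) hvp
    (log r)
  simp only [exp_log hr'] at h
  rw [← h, add_sub_cancel_right, exp_log (hg'.1 r hr)]
end

section
/- Let f be a positive function on (0,∞) such that r ↦ f(r)^m/m is twice continuously differentiable on (0,∞), (f^m/m)''(r) + ((n-1)/r)·(f^m/m)'(r) + α·f(r) + β·r·f'(r) = 0 for all r > 0, and lim_{r→0+} r^{α/β}·f(r) = η. Then lim_{r→∞} r²·f(r)^{1-m} = 2(n-2-nm)/((1-m)·ρ1). -/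
open Real Set Filter

/-- radially symmetric solution of `Δ(f^m/m) + α f + β x·∇f = 0` on `(0,∞)`
with `lim_{r→0+} r^{α/β} f(r) = η`. -/
def FDESol (n : ℕ) (m α β η : ℝ) (f : ℝ → ℝ) : Prop :=
  (∀ r ∈ Set.Ioi (0 : ℝ), 0 < f r) ∧
  ContDiffOn ℝ 2 (fun r => f r ^ m / m) (Set.Ioi 0) ∧
  (∀ r ∈ Set.Ioi (0 : ℝ),
    deriv (deriv (fun r' => f r' ^ m / m)) r
      + (((n : ℝ) - 1) / r) * deriv (fun r' => f r' ^ m / m) r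
      + α * f r + β * r * deriv f r = 0) ∧
  Filter.Tendsto (fun r => r ^ (α / β) * f r) (nhdsWithin 0 (Set.Ioi 0)) (nhds η)

/-- If `W` converges at infinity and its second derivative is bounded, then its derivative
tends to zero. -/
theorem tendsto_deriv_zero_of_bounded_second_deriv {W D E : ℝ → ℝ} {T M ℓ : ℝ}
    (hW : ∀ t, T < t → HasDerivAt W (D t) t) (hD : ∀ t, T < t → HasDerivAt D (E t) t)
    (hE : ∀ t, T < t → |E t| ≤ M) (hl : Tendsto W atTop (nhds ℓ)) :
    Tendsto D atTop (nhds 0) := by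
  have hM : 0 ≤ M := (abs_nonneg _).trans (hE (T + 1) (by linarith))
  rw [Metric.tendsto_nhds]
  intro ε hε
  set h : ℝ := ε / (2 * (M + 1)) with hh
  have hpos : 0 < h := by positivity
  have hMh : M * h < ε / 2 := by
    rw [hh, mul_div_assoc', div_lt_div_iff₀ (by positivity) (by norm_num)]
    nlinarith
  have hdiff : Tendsto (fun t => W (t + h) - W t) atTop (nhds 0) := by
    simpa using (hl.comp (tendsto_atTop_add_const_right atTop h tendsto_id)).sub hl
  have hev := (Metric.tendsto_nhds.mp hdiff) (h * (ε / 2)) (by positivity)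
  filter_upwards [hev, eventually_gt_atTop T] with t ht hTt
  rw [Real.dist_eq, sub_zero] at ht ⊢
  obtain ⟨ξ, hξ, hξe⟩ := exists_hasDerivAt_eq_slope W D (show t < t + h by linarith)
    (fun x hx => (hW x (by linarith [hx.1])).continuousAt.continuousWithinAt)
    (fun x hx => hW x (by linarith [hx.1]))
  obtain ⟨ζ, hζ, hζe⟩ := exists_hasDerivAt_eq_slope D E hξ.1
    (fun x hx => (hD x (by linarith [hx.1])).continuousAt.continuousWithinAt)
    (fun x hx => hD x (by linarith [hx.1]))
  have h1 : |D ξ| < ε / 2 := by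
    rw [hξe, add_sub_cancel_left, abs_div, abs_of_pos hpos, div_lt_iff₀ hpos]
    linarith
  have h2 : D ξ - D t = E ζ * (ξ - t) := by
    rw [hζe, div_mul_cancel₀ _ (by linarith [hξ.1])]
  have h3 : |D ξ - D t| ≤ M * h := by
    rw [h2, abs_mul, abs_of_pos (by linarith [hξ.1] : (0 : ℝ) < ξ - t)]
    exact mul_le_mul (hE ζ (by linarith [hζ.1])) (by linarith [hξ.2]) (by linarith [hξ.1]) hM
  rw [abs_lt] at h1 ⊢
  rw [abs_le] at h3
  constructor <;> linarith [h1.1, h1.2, h3.1, h3.2]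

/-- The tangent line bound for the logarithm at `a`. -/
theorem log_le_div_add_log_sub_one {a x : ℝ} (ha : 0 < a) (hx : 0 < x) :
    log x ≤ x / a + log a - 1 := by
  have h := Real.log_le_sub_one_of_pos (div_pos hx ha)
  rw [Real.log_div hx.ne' ha.ne'] at h
  linarith

theorem le_sub_mul_log {a x : ℝ} (ha : 0 < a) (hx : 0 < x) : a - a * log a ≤ x - a * log x := by
  have h := mul_le_mul_of_nonneg_left (log_le_div_add_log_sub_one ha hx) ha.le
  have h2 : a * (x / a + log a - 1) = x + a * log a - a := by field_simp
  linarith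

/-- Sublevel sets of `x ↦ x - a * log x` on the positive half line are relatively compact. -/
theorem exists_bounds_of_sub_mul_log_le {a : ℝ} (ha : 0 < a) (K : ℝ) :
    ∃ l u : ℝ, 0 < l ∧ ∀ x, 0 < x → x - a * log x ≤ K → x ∈ Icc l u := by
  refine ⟨exp (-K / a), 2 * (K + a * log (2 * a)), exp_pos _, fun x hx hK => ⟨?_, ?_⟩⟩
  · rw [← Real.le_log_iff_exp_le hx, div_le_iff₀ ha]
    linarith
  · have h := mul_le_mul_of_nonneg_left
      (log_le_div_add_log_sub_one (by positivity : 0 < 2 * a) hx) ha.le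
    have h2 : a * (x / (2 * a) + log (2 * a) - 1) = x / 2 + a * log (2 * a) - a := by field_simp
    linarith

/-- Global convergence of the positive solutions of a damped Lotka–Volterra system. -/
theorem tendsto_of_damped_lotkaVolterra {q w : ℝ → ℝ} {a₀ a₁ a₂ b k q₀ w₀ T : ℝ}
    (ha₀ : 0 < a₀) (ha₂ : 0 < a₂) (hb : 0 < b) (hk : 0 < k) (hq₀ : 0 < q₀) (hw₀ : 0 < w₀)
    (heq : a₀ + a₁ * q₀ - a₂ * q₀ ^ 2 = b * w₀ * q₀)
    (hq : ∀ s, HasDerivAt q (a₀ + a₁ * q s - a₂ * q s ^ 2 - b * w s * q s) s)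
    (hw : ∀ s, HasDerivAt w (k * w s * (q s - q₀)) s)
    (hwpos : ∀ s, 0 < w s) (hqpos : ∀ s, T < s → 0 < q s) :
    Tendsto w atTop (nhds w₀) := by
  set V : ℝ → ℝ := fun s => b * (w s - w₀ * log (w s)) + k * (q s - q₀ * log (q s)) with hV
  set D : ℝ → ℝ := fun s => -(k * (q s - q₀) ^ 2 * (a₂ + a₀ / (q s * q₀))) with hD
  have hVD : ∀ s, T < s → HasDerivAt V (D s) s := by
    intro s hs
    have hqs := hqpos s hs
    have hws := hwpos s
    refine ((((hw s).sub (((hw s).log hws.ne').const_mul w₀)).const_mul b).add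
      (((hq s).sub (((hq s).log hqs.ne').const_mul q₀)).const_mul k)).congr_deriv ?_
    have e1 : b * w₀ = (a₀ + a₁ * q₀ - a₂ * q₀ ^ 2) / q₀ := by
      rw [heq]; field_simp
    have e2 : b * (k * w s * (q s - q₀) - w₀ * (k * w s * (q s - q₀) / w s))
        = k * (q s - q₀) * (b * w s - b * w₀) := by
      field_simp
    rw [e2, e1, hD]
    field_simp
    ring
  have hanti : AntitoneOn V (Ioi T) := by
    refine antitoneOn_of_deriv_nonpos (convex_Ioi T)
      (fun s hs => (hVD s hs).continuousAt.continuousWithinAt) ?_ ?_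
    · rw [interior_Ioi]
      exact fun s hs => (hVD s hs).differentiableAt.differentiableWithinAt
    · rw [interior_Ioi]
      intro s hs
      rw [(hVD s hs).deriv]
      have := hqpos s hs
      simp only [hD, neg_nonpos]
      positivity
  have hlow : ∀ s, T < s → b * (w₀ - w₀ * log w₀) + k * (q₀ - q₀ * log q₀) ≤ V s := fun s hs =>
    add_le_add (mul_le_mul_of_nonneg_left (le_sub_mul_log hw₀ (hwpos s)) hb.le)
      (mul_le_mul_of_nonneg_left (le_sub_mul_log hq₀ (hqpos s hs)) hk.le)
  obtain ⟨ℓ, hℓ⟩ : ∃ ℓ, Tendsto V atTop (nhds ℓ) := by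
    have hanti' : Antitone (fun s => V (max s (T + 1))) := fun x y hxy =>
      hanti (lt_of_lt_of_le (lt_add_one T) (le_max_right _ _))
        (lt_of_lt_of_le (lt_add_one T) (le_max_right _ _)) (max_le_max_right _ hxy)
    have hbdd : BddBelow (range fun s => V (max s (T + 1))) := by
      refine ⟨b * (w₀ - w₀ * log w₀) + k * (q₀ - q₀ * log q₀), ?_⟩
      rintro _ ⟨s, rfl⟩
      exact hlow _ (lt_of_lt_of_le (lt_add_one T) (le_max_right _ _))
    refine ⟨_, (tendsto_atTop_ciInf hanti' hbdd).congr' ?_⟩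
    filter_upwards [eventually_ge_atTop (T + 1)] with s hs
    rw [max_eq_left hs]
  -- the trajectory stays in a compact subset of the open quadrant
  have hVle : ∀ s, T + 1 < s → V s ≤ V (T + 1) := fun s hs =>
    hanti (by simp) (by simp only [mem_Ioi]; linarith) hs.le
  obtain ⟨lw, uw, hlw, hwb⟩ := exists_bounds_of_sub_mul_log_le hw₀
    ((V (T + 1) - k * (q₀ - q₀ * log q₀)) / b)
  obtain ⟨lq, uq, hlq, hqb⟩ := exists_bounds_of_sub_mul_log_le hq₀
    ((V (T + 1) - b * (w₀ - w₀ * log w₀)) / k)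
  have hmem : ∀ s, T + 1 < s → (q s, w s) ∈ Icc lq uq ×ˢ Icc lw uw := by
    intro s hs
    have hqs := hqpos s (by linarith)
    have h1 := hVle s hs
    have h2 := mul_le_mul_of_nonneg_left (le_sub_mul_log hw₀ (hwpos s)) hb.le
    have h3 := mul_le_mul_of_nonneg_left (le_sub_mul_log hq₀ hqs) hk.le
    refine ⟨hqb _ hqs ?_, hwb _ (hwpos s) ?_⟩
    · rw [le_div_iff₀ hk]
      simp only [hV] at h1 ⊢
      linarith
    · rw [le_div_iff₀ hb]
      simp only [hV] at h1 ⊢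
      linarith
  have hcpt : IsCompact (Icc lq uq ×ˢ Icc lw uw) := isCompact_Icc.prod isCompact_Icc
  have hne : ∀ x ∈ Icc lq uq ×ˢ Icc lw uw, x.1 ≠ 0 := fun x hx =>
    (lt_of_lt_of_le hlq hx.1.1).ne'
  have hqlim : Tendsto q atTop (nhds q₀) := by
    let E : ℝ × ℝ → ℝ := fun x =>
      -(k * (2 * (x.1 - q₀)) * (a₂ + a₀ / (x.1 * q₀)) - k * (x.1 - q₀) ^ 2 * (a₀ / (x.1 ^ 2 * q₀)))
        * (a₀ + a₁ * x.1 - a₂ * x.1 ^ 2 - b * x.2 * x.1)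
    have hEc : ContinuousOn E (Icc lq uq ×ˢ Icc lw uw) := by
      have h1 : ∀ x ∈ Icc lq uq ×ˢ Icc lw uw, x.1 * q₀ ≠ 0 := fun x hx =>
        mul_ne_zero (hne x hx) hq₀.ne'
      have h2 : ∀ x ∈ Icc lq uq ×ˢ Icc lw uw, x.1 ^ 2 * q₀ ≠ 0 := fun x hx =>
        mul_ne_zero (pow_ne_zero 2 (hne x hx)) hq₀.ne'
      fun_prop (disch := assumption)
    obtain ⟨M, hM⟩ := hcpt.exists_bound_of_continuousOn hEc
    have hD0 : Tendsto D atTop (nhds 0) := by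
      refine tendsto_deriv_zero_of_bounded_second_deriv (E := fun s => E (q s, w s)) (T := T + 1)
        (M := M) (fun s hs => hVD s (by linarith)) (fun s hs => ?_)
        (fun s hs => hM _ (hmem s hs)) hℓ
      have hqs := hqpos s (by linarith)
      refine (((((hq s).sub_const q₀).pow 2).const_mul k).mul
        ((((hasDerivAt_const s a₀).div ((hq s).mul_const q₀)
          (by positivity)).const_add a₂))).neg.congr_deriv ?_
      simp only [E, Pi.pow_apply, Pi.div_apply]
      field_simp
      ring
    have hsq : Tendsto (fun s => (q s - q₀) ^ 2) atTop (nhds 0) := by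
      have hup : Tendsto (fun s => -D s / (k * a₂)) atTop (nhds 0) := by
        simpa using hD0.neg.div_const (k * a₂)
      refine tendsto_of_tendsto_of_tendsto_of_le_of_le' tendsto_const_nhds hup
        (Eventually.of_forall fun s => sq_nonneg _) ?_
      filter_upwards [eventually_gt_atTop T] with s hs
      have hqs := hqpos s hs
      rw [le_div_iff₀ (by positivity)]
      have : 0 ≤ k * (q s - q₀) ^ 2 * (a₀ / (q s * q₀)) := by positivity
      simp only [hD]
      linarith
    have habs : Tendsto (fun s => |q s - q₀|) atTop (nhds 0) := by
      simpa [Real.sqrt_sq_eq_abs] using hsq.sqrt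
    exact tendsto_sub_nhds_zero_iff.mp ((tendsto_zero_iff_abs_tendsto_zero _).mpr habs)
  let R : ℝ × ℝ → ℝ := fun x => a₁ * (a₀ + a₁ * x.1 - a₂ * x.1 ^ 2 - b * x.2 * x.1)
    - a₂ * (2 * x.1) * (a₀ + a₁ * x.1 - a₂ * x.1 ^ 2 - b * x.2 * x.1)
    - b * (k * x.2 * (x.1 - q₀) * x.1 + x.2 * (a₀ + a₁ * x.1 - a₂ * x.1 ^ 2 - b * x.2 * x.1))
  obtain ⟨M, hM⟩ := hcpt.exists_bound_of_continuousOn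
    (f := R) (by simp only [R]; fun_prop)
  have hq' : Tendsto (fun s => a₀ + a₁ * q s - a₂ * q s ^ 2 - b * w s * q s) atTop (nhds 0) := by
    refine tendsto_deriv_zero_of_bounded_second_deriv (E := fun s => R (q s, w s)) (T := T + 1)
      (M := M) (fun s _ => hq s) (fun s _ => ?_) (fun s hs => hM _ (hmem s hs)) hqlim
    refine (((((hq s).const_mul a₁).const_add a₀).sub (((hq s).pow 2).const_mul a₂)).sub
      (((hw s).const_mul b).mul (hq s))).congr_deriv ?_
    simp only [R]
    ring
  have hfin : Tendsto (fun s => (a₀ + a₁ * q s - a₂ * q s ^ 2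
      - (a₀ + a₁ * q s - a₂ * q s ^ 2 - b * w s * q s)) / (b * q s)) atTop
      (nhds ((a₀ + a₁ * q₀ - a₂ * q₀ ^ 2 - 0) / (b * q₀))) :=
    Tendsto.div ((((hqlim.const_mul a₁).const_add a₀).sub ((hqlim.pow 2).const_mul a₂)).sub hq')
      (hqlim.const_mul b) (by positivity)
  have hval : (a₀ + a₁ * q₀ - a₂ * q₀ ^ 2 - 0) / (b * q₀) = w₀ := by
    rw [heq]; field_simp; ring
  rw [hval] at hfin
  refine hfin.congr' ?_
  filter_upwards [eventually_gt_atTop T] with s hs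
  have hqs := hqpos s hs
  field_simp
  ring

/-- A solution of the damped equation for `q` is eventually positive, provided that `w` blows up
at `-∞` and that `q` has a primitive which converges there. -/
theorem exists_pos_of_tendsto_atBot {q w P : ℝ → ℝ} {a₀ a₁ a₂ b c ℓ : ℝ}
    (ha₀ : 0 < a₀) (ha₂ : 0 < a₂) (hb : 0 < b) (hc : 0 < c)
    (hq : ∀ s, HasDerivAt q (a₀ + a₁ * q s - a₂ * q s ^ 2 - b * w s * q s) s)
    (hw : Tendsto w atBot atTop) (hP : ∀ s, HasDerivAt P (c * q s) s)
    (hPl : Tendsto P atBot (nhds ℓ)) :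
    ∃ T, ∀ s, T < s → 0 < q s := by
  obtain ⟨S, hS⟩ : ∃ S, ∀ s ≤ S, (a₁ + a₂) / b ≤ w s :=
    eventually_atBot.mp (hw.eventually_ge_atTop _)
  have hdiff : Tendsto (fun s => P (s + 1) - P s) atBot (nhds 0) := by
    simpa using (hPl.comp (tendsto_atBot_add_const_right atBot 1 tendsto_id)).sub hPl
  obtain ⟨S', hS'⟩ : ∃ S', ∀ s ≤ S', dist (P (s + 1) - P s) 0 < c :=
    eventually_atBot.mp ((Metric.tendsto_nhds.mp hdiff) c hc)
  set s₀ := min S' (S - 1 - 2 / a₀) with hs₀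
  obtain ⟨ξ, hξ, hξe⟩ := exists_hasDerivAt_eq_slope P (fun s => c * q s)
    (show s₀ < s₀ + 1 by linarith) (fun x _ => (hP x).continuousAt.continuousWithinAt)
    (fun x _ => hP x)
  have hqξ : -1 < q ξ := by
    have h := hS' s₀ (min_le_left _ _)
    rw [add_sub_cancel_left, div_one] at hξe
    rw [Real.dist_eq, sub_zero, ← hξe, abs_lt] at h
    by_contra hcon
    nlinarith [h.1]
  set T := ξ + 2 / a₀ with hT
  have hTS : T ≤ S := by
    have := min_le_right S' (S - 1 - 2 / a₀)
    linarith [hξ.2]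
  have hξT : ξ ≤ T := by
    have : 0 < 2 / a₀ := by positivity
    linarith
  have hqT : 0 ≤ q T := by
    have key := image_le_of_deriv_right_lt_deriv_boundary (f := fun s => -q s)
      (f' := fun s => -(a₀ + a₁ * q s - a₂ * q s ^ 2 - b * w s * q s)) (a := ξ) (b := T)
      (B := fun s => 1 - a₀ / 2 * (s - ξ)) (B' := fun _ => -(a₀ / 2))
      (fun s _ => (hq s).neg.continuousAt.continuousWithinAt)
      (fun s _ => (hq s).neg.hasDerivWithinAt) (by simp; linarith)
      (fun s => ((((hasDerivAt_id s).sub_const ξ).const_mul (a₀ / 2)).const_sub 1).congr_deriv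
        (by ring))
      (fun s hs hsB => by
        have h1 : a₀ / 2 * (s - ξ) ≤ 1 := by
          have : s - ξ ≤ 2 / a₀ := by linarith [hs.2]
          calc a₀ / 2 * (s - ξ) ≤ a₀ / 2 * (2 / a₀) := by gcongr
            _ = 1 := by field_simp
        have h2 : 0 ≤ a₀ / 2 * (s - ξ) := mul_nonneg (by positivity) (by linarith [hs.1])
        have h3 := hS s (by linarith [hs.2])
        rw [div_le_iff₀ hb] at h3
        have h4 : q s ≤ 0 := by linarith
        have h5 : -1 ≤ q s := by linarith
        nlinarith [mul_nonneg (neg_nonneg.mpr h4) (sub_nonneg.mpr h3),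
          mul_nonneg (mul_nonneg ha₂.le (neg_nonneg.mpr h4)) (by linarith : 0 ≤ 1 + q s)])
      (right_mem_Icc.mpr hξT)
    have h1 : 1 - a₀ / 2 * (T - ξ) = 0 := by rw [hT]; field_simp; ring
    simp only [h1] at key
    linarith
  have hnonneg : ∀ s, T ≤ s → 0 ≤ q s := by
    intro s hs
    have key := image_le_of_deriv_right_lt_deriv_boundary (f := fun s => -q s)
      (f' := fun s => -(a₀ + a₁ * q s - a₂ * q s ^ 2 - b * w s * q s)) (a := T) (b := s)
      (B := fun _ => 0) (B' := fun _ => 0)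
      (fun s _ => (hq s).neg.continuousAt.continuousWithinAt)
      (fun s _ => (hq s).neg.hasDerivWithinAt) (by simpa using hqT)
      (fun s => hasDerivAt_const s 0)
      (fun s _ hsB => by
        have : q s = 0 := by linarith
        simp [this, ha₀])
      (right_mem_Icc.mpr hs)
    linarith
  refine ⟨T, fun s hs => (hnonneg s hs.le).lt_of_ne' fun h0 => ?_⟩
  have hmin : IsLocalMin q s := by
    filter_upwards [Ioi_mem_nhds hs] with x hx
    rw [h0]
    exact hnonneg x (le_of_lt hx)
  have h := hmin.hasDerivAt_eq_zero (hq s)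
  rw [h0] at h
  linarith

namespace FDESol

variable {n : ℕ} {m α β η : ℝ} {f : ℝ → ℝ}

theorem hasDerivAt_rpow_div (hf : FDESol n m α β η f) {r : ℝ} (hr : 0 < r) :
    HasDerivAt (fun r => f r ^ m / m) (deriv (fun r => f r ^ m / m) r) r :=
  ((hf.2.1.differentiableOn (by norm_num)).differentiableAt (Ioi_mem_nhds hr)).hasDerivAt

theorem hasDerivAt_deriv_rpow_div (hf : FDESol n m α β η f) {r : ℝ} (hr : 0 < r) :
    HasDerivAt (deriv (fun r => f r ^ m / m)) (deriv (deriv (fun r => f r ^ m / m)) r) r :=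
  (((hf.2.1.deriv_of_isOpen isOpen_Ioi (m := 1) (by norm_num)).differentiableOn
    (by norm_num)).differentiableAt (Ioi_mem_nhds hr)).hasDerivAt

theorem hasDerivAt (hf : FDESol n m α β η f) (hm : 0 < m) {r : ℝ} (hr : 0 < r) :
    HasDerivAt f (f r ^ (1 - m) * deriv (fun r => f r ^ m / m) r) r := by
  have hfr := hf.1 r hr
  have h1 := ((hf.hasDerivAt_rpow_div hr).const_mul m).rpow_const (p := 1 / m)
    (Or.inl (by positivity))
  refine (h1.congr_of_eventuallyEq ?_).congr_deriv ?_
  · filter_upwards [Ioi_mem_nhds hr] with x hx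
    rw [mul_div_cancel₀ _ hm.ne', ← rpow_mul (hf.1 x hx).le, mul_one_div_cancel hm.ne', rpow_one]
  · rw [mul_div_cancel₀ _ hm.ne', ← rpow_mul hfr.le,
      show m * (1 / m - 1) = 1 - m by field_simp]
    field_simp

/-- `r ^ 2 * f r ^ (1 - m)` in the logarithmic variable `s = log r`. -/
noncomputable def scaled (m : ℝ) (f : ℝ → ℝ) (s : ℝ) : ℝ := exp s ^ 2 * f (exp s) ^ (1 - m)

/-- `α + β * (r * f' r / f r)` in the logarithmic variable `s = log r`. -/
noncomputable def slope (m α β : ℝ) (f : ℝ → ℝ) (s : ℝ) : ℝ :=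
  α + β * (exp s * deriv (fun r => f r ^ m / m) (exp s) / f (exp s) ^ m)

theorem scaled_pos (hf : FDESol n m α β η f) (s : ℝ) : 0 < scaled m f s :=
  mul_pos (pow_pos (exp_pos s) 2) (rpow_pos_of_pos (hf.1 _ (exp_pos s)) _)

theorem hasDerivAt_log (hf : FDESol n m α β η f) (hm : 0 < m) (hβ : 0 < β) (s : ℝ) :
    HasDerivAt (fun s => log (f (exp s))) ((slope m α β f s - α) / β) s := by
  have hfr := hf.1 _ (exp_pos s)
  refine (((hf.hasDerivAt hm (exp_pos s)).comp s (Real.hasDerivAt_exp s)).log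
    hfr.ne').congr_deriv ?_
  have hY : f (exp s) ^ (1 - m) * f (exp s) ^ m = f (exp s) := by
    rw [← rpow_add hfr, sub_add_cancel, rpow_one]
  have hYp := rpow_pos_of_pos hfr m
  have hZp := rpow_pos_of_pos hfr (1 - m)
  simp only [slope, Function.comp]
  rw [add_sub_cancel_left, mul_div_cancel_left₀ _ hβ.ne', div_eq_div_iff hfr.ne' hYp.ne']
  linear_combination (exp s * deriv (fun r => f r ^ m / m) (exp s)) * hY

theorem scaled_eq_exp (hf : FDESol n m α β η f) (s : ℝ) :
    scaled m f s = exp (2 * s + (1 - m) * log (f (exp s))) := by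
  rw [scaled, exp_add, rpow_def_of_pos (hf.1 _ (exp_pos s)), mul_comm (log _), ← Real.exp_nat_mul]
  norm_num

theorem hasDerivAt_scaled (hf : FDESol n m α β η f) (hm : 0 < m) (hβ : 0 < β) (s : ℝ) :
    HasDerivAt (scaled m f)
      (scaled m f s * (2 + (1 - m) * ((slope m α β f s - α) / β))) s := by
  have h := (((hasDerivAt_id s).const_mul 2).add
    ((hf.hasDerivAt_log hm hβ s).const_mul (1 - m))).exp
  refine (h.congr_of_eventuallyEq (Eventually.of_forall hf.scaled_eq_exp)).congr_deriv ?_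
  rw [hf.scaled_eq_exp s]
  simp

theorem hasDerivAt_slope (hf : FDESol n m α β η f) (hm : 0 < m) (hβ : 0 < β) (s : ℝ) :
    HasDerivAt (slope m α β f)
      (β * (-(m * ((slope m α β f s - α) / β) ^ 2) - ((n : ℝ) - 2) * ((slope m α β f s - α) / β)
        - scaled m f s * slope m α β f s)) s := by
  have hr := exp_pos s
  have hfr := hf.1 _ hr
  have hY : f (exp s) ^ (1 - m) * f (exp s) ^ m = f (exp s) := by
    rw [← rpow_add hfr, sub_add_cancel, rpow_one]
  have hYp := rpow_pos_of_pos hfr m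
  have hode := hf.2.2.1 _ hr
  rw [(hf.hasDerivAt hm hr).deriv] at hode
  have hpow : HasDerivAt (fun r => f r ^ m) (m * deriv (fun r => f r ^ m / m) (exp s)) (exp s) := by
    refine ((hf.hasDerivAt_rpow_div hr).const_mul m).congr_of_eventuallyEq
      (Eventually.of_forall fun x => ?_)
    simp only
    rw [mul_div_cancel₀ _ hm.ne']
  have hexp := Real.hasDerivAt_exp s
  have h := ((((hexp.mul ((hf.hasDerivAt_deriv_rpow_div hr).comp s hexp)).div
    (hpow.comp s hexp) hYp.ne').const_mul β).const_add α)
  refine h.congr_deriv ?_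
  simp only [slope, scaled, Function.comp, Pi.mul_apply]
  rw [add_sub_cancel_left, mul_div_cancel_left₀ _ hβ.ne']
  generalize deriv (deriv fun r => f r ^ m / m) (exp s) = g₂ at *
  generalize deriv (fun r => f r ^ m / m) (exp s) = g₁ at *
  generalize f (exp s) ^ m = Y at *
  generalize f (exp s) ^ (1 - m) = Z at *
  generalize f (exp s) = y at *
  generalize exp s = r at *
  subst hY
  have hg₂ : g₂ = -(((n : ℝ) - 1) / r * g₁ + α * (Z * Y) + β * r * (Z * g₁)) := by
    linear_combination hode
  rw [hg₂]
  field_simp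
  ring

/-- The logarithm of `r ^ (α / β) * f r` in the variable `s = log r` converges at `-∞`. -/
theorem tendsto_log_atBot (hf : FDESol n m α β η f) (hη : 0 < η) :
    Tendsto (fun s => α / β * s + log (f (exp s))) atBot (nhds (log η)) := by
  have h := ((hf.2.2.2.comp tendsto_exp_atBot_nhdsGT).log hη.ne')
  refine h.congr fun s => ?_
  have hfr := hf.1 _ (exp_pos s)
  simp only [Function.comp]
  rw [log_mul (rpow_pos_of_pos (exp_pos s) _).ne' hfr.ne', log_rpow (exp_pos s), log_exp]

end FDESol

theorem stmt4 (n : ℕ) (m ρ1 η β α : ℝ)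
    (hn : 3 ≤ n) (hm0 : 0 < m) (hm1 : m < ((n : ℝ) - 2) / (n : ℝ))
    (hρ1 : 0 < ρ1) (hη : 0 < η)
    (hβ : m * ρ1 / ((n : ℝ) - 2 - (n : ℝ) * m) < β)
    (hα : α = (2 * β + ρ1) / (1 - m))
    (f : ℝ → ℝ) (hf : FDESol n m α β η f) :
    Filter.Tendsto (fun r => r ^ 2 * f r ^ (1 - m)) Filter.atTop
      (nhds (2 * ((n : ℝ) - 2 - (n : ℝ) * m) / ((1 - m) * ρ1))) := by
  have hn' : (3 : ℝ) ≤ n := by exact_mod_cast hn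
  have hN : 0 < (n : ℝ) - 2 - n * m := by
    rw [lt_div_iff₀ (by linarith)] at hm1
    linarith
  have hm : 0 < 1 - m := by nlinarith
  have hβ0 : 0 < β := lt_of_le_of_lt (by positivity) hβ
  have hβN : m * ρ1 < β * ((n : ℝ) - 2 - n * m) := (div_lt_iff₀ hN).mp hβ
  have hα0 : 0 < α := by rw [hα]; positivity
  have hαm : α * (1 - m) = 2 * β + ρ1 := by rw [hα]; field_simp
  have hC : 0 < ((n : ℝ) - 2) * β - m * α := by
    have : 0 < (((n : ℝ) - 2) * β - m * α) * (1 - m) := by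
      linear_combination hβN + m * hαm
    exact pos_of_mul_pos_left this hm.le
  have hq : ∀ s, HasDerivAt (FDESol.slope m α β f)
      (α / β * (((n : ℝ) - 2) * β - m * α) + (2 * m * α / β - ((n : ℝ) - 2))
        * FDESol.slope m α β f s - m / β * FDESol.slope m α β f s ^ 2
        - β * FDESol.scaled m f s * FDESol.slope m α β f s) s := fun s =>
    (hf.hasDerivAt_slope hm0 hβ0 s).congr_deriv (by field_simp; ring)
  have hw : ∀ s, HasDerivAt (FDESol.scaled m f) ((1 - m) / β * FDESol.scaled m f s
      * (FDESol.slope m α β f s - ρ1 / (1 - m))) s := fun s =>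
    (hf.hasDerivAt_scaled hm0 hβ0 s).congr_deriv (by
      field_simp
      linear_combination -FDESol.scaled m f s * hαm)
  have hP : ∀ s, HasDerivAt (fun s => α / β * s + log (f (exp s)))
      (1 / β * FDESol.slope m α β f s) s := fun s =>
    (((hasDerivAt_id s).const_mul (α / β)).add (hf.hasDerivAt_log hm0 hβ0 s)).congr_deriv
      (by field_simp; ring)
  have hPl := hf.tendsto_log_atBot hη
  have hwl : Tendsto (FDESol.scaled m f) atBot atTop := by
    have h1 : Tendsto (fun s : ℝ => -(ρ1 / β) * s) atBot atTop :=
      tendsto_id.const_mul_atBot_of_neg (neg_neg_of_pos (by positivity))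
    have h2 := tendsto_exp_atTop.comp (h1.atTop_add (hPl.const_mul (1 - m)))
    refine h2.congr fun s => ?_
    rw [hf.scaled_eq_exp, Function.comp]
    congr 1
    field_simp
    linear_combination s * hαm
  obtain ⟨T, hT⟩ := exists_pos_of_tendsto_atBot (by positivity) (by positivity) hβ0
    (by positivity) hq hwl hP hPl
  have hlim : Tendsto (FDESol.scaled m f) atTop
      (nhds (2 * ((n : ℝ) - 2 - (n : ℝ) * m) / ((1 - m) * ρ1))) := by
    refine tendsto_of_damped_lotkaVolterra (by positivity) (by positivity) hβ0 (by positivity)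
      (by positivity) (by positivity) ?_ hq hw hf.scaled_pos hT
    rw [hα]
    field_simp
    ring
  refine (hlim.comp tendsto_log_atTop).congr' ?_
  filter_upwards [eventually_gt_atTop 0] with r hr
  simp only [Function.comp, FDESol.scaled, exp_log hr]
end

section
/- There exists a constant b1 > 0 such that there is exactly one continuously differentiable function z on (-∞,-b1) satisfying z'(s) + (n-2-2mα/β)·z(s) + m·z(s)² + β·e^{-(ρ1/β)s}·w̃(s)^{1-m}·z(s) = (α/β)(n-2-mα/β) for all s < -b1, where w̃(s) = η·exp(∫_{-∞}^{s} z(ρ) dρ), and such that 0 < z(s)·e^{-(ρ1/β)s} ≤ C4·η^{m-1} for all s < -b1. -/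
open Real Set Filter MeasureTheory

/-- `z` is a solution on `(-∞, -b1)` of the ODE
`z' + (n-2-2mα/β) z + m z² + β e^{-(ρ1/β)s} w̃^{1-m} z = (α/β)(n-2-mα/β)` where
`w̃(s) = η exp(∫_{-∞}^s z)`, satisfying `0 < z(s) e^{-(ρ1/β)s} ≤ C4 η^{m-1}`. -/
def ZODE (n : ℕ) (m ρ1 η β α C4 b1 : ℝ) (z : ℝ → ℝ) : Prop :=
  ContDiffOn ℝ 1 z (Set.Iio (-b1)) ∧
  (∀ s < -b1, MeasureTheory.IntegrableOn z (Set.Iio s)) ∧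
  (∀ s < -b1,
    deriv z s + ((n : ℝ) - 2 - 2 * m * α / β) * z s + m * z s ^ 2
      + β * Real.exp (-(ρ1 / β) * s) *
          (η * Real.exp (∫ ρ in Set.Iio s, z ρ)) ^ (1 - m) * z s
      = α / β * ((n : ℝ) - 2 - m * α / β)) ∧
  (∀ s < -b1, 0 < z s * Real.exp (-(ρ1 / β) * s) ∧
    z s * Real.exp (-(ρ1 / β) * s) ≤ C4 * η ^ (m - 1))

/-- The improper integral `∫_{-∞}^s f` of a continuous function has derivative `f`. -/
lemma hasDerivAt_integral_Iio {f : ℝ → ℝ} (hf : Continuous f) {b s : ℝ}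
    (hi : IntegrableOn f (Iio b)) (hs : s < b) :
    HasDerivAt (fun t => ∫ x in Iio t, f x) (f s) s := by
  have hint : ∀ t < b, IntegrableOn f (Iic t) := fun t ht =>
    hi.mono_set (Iic_subset_Iio.2 ht)
  have h : HasDerivAt (fun t => (∫ x in Iic s, f x) + ∫ x in s..t, f x) (f s) s :=
    (intervalIntegral.integral_hasDerivAt_right (hf.intervalIntegrable _ _)
      (hf.stronglyMeasurableAtFilter _ _) hf.continuousAt).const_add _
  refine h.congr_of_eventuallyEq ?_
  filter_upwards [Iio_mem_nhds hs] with t ht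
  rw [← intervalIntegral.integral_Iic_sub_Iic (hint s hs) (hint t ht),
    add_sub_cancel, integral_Iic_eq_integral_Iio]

/-- A function vanishing at `-∞` that does not increase where it is positive is nonpositive. -/
lemma nonpos_of_tendsto_atBot_of_deriv_nonpos {d d' : ℝ → ℝ} {b : ℝ}
    (hd : ∀ s < b, HasDerivAt d (d' s) s) (hlim : Tendsto d atBot (nhds 0))
    (hneg : ∀ s < b, 0 < d s → d' s ≤ 0) : ∀ s < b, d s ≤ 0 := by
  intro s hs
  refine le_of_forall_pos_le_add fun ε hε => ?_
  rw [zero_add]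
  obtain ⟨a, hda, has⟩ :=
    ((hlim.eventually (gt_mem_nhds (half_pos hε))).and (eventually_lt_atBot s)).exists
  have hsa : 0 < s - a := sub_pos.2 has
  set δ := ε / 2 / (s - a) with hδ
  have hδ0 : 0 < δ := by positivity
  have key := image_le_of_deriv_right_lt_deriv_boundary (f := d) (f' := d') (a := a) (b := s)
    (B := fun x => ε / 2 + δ * (x - a)) (B' := fun _ => δ)
    (fun x hx => (hd x (hx.2.trans_lt hs)).continuousAt.continuousWithinAt)
    (fun x hx => (hd x (hx.2.trans hs)).hasDerivWithinAt) (by simpa using hda.le)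
    (fun x => by simpa using (((hasDerivAt_id x).sub_const a).const_mul δ).const_add (ε / 2))
    (fun x hx hxe => by
      have : 0 ≤ δ * (x - a) := mul_nonneg hδ0.le (sub_nonneg.2 hx.1)
      exact (hneg x (hx.2.trans hs) (by rw [hxe]; positivity)).trans_lt hδ0)
    (right_mem_Icc.2 has.le)
  have h2 : δ * (s - a) = ε / 2 := by rw [hδ]; field_simp
  simp only [h2] at key
  linarith

/-- The linear equation `y' = c - P y` with strong damping `P` near `-∞` has a positive solution
decaying at the rate of `1 / P`. -/
lemma exists_linear_solution {P : ℝ → ℝ} (hP : Continuous P) {c M κ b : ℝ} (hc : 0 < c)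
    (hM : 0 < M) (hκ : 0 < κ) (hPM : ∀ s < b, M * exp (-κ * s) ≤ P s) :
    ∃ y : ℝ → ℝ, ∀ s < b, HasDerivAt y (c - P s * y s) s ∧ 0 < y s ∧
      y s ≤ c / M * exp (κ * s) := by
  set Q : ℝ → ℝ := fun s => ∫ x in (0 : ℝ)..s, P x
  have hQd : ∀ s, HasDerivAt Q (P s) s := fun s =>
    intervalIntegral.integral_hasDerivAt_right (hP.intervalIntegrable _ _)
      (hP.stronglyMeasurableAtFilter _ _) hP.continuousAt
  have hQc : Continuous Q := continuous_iff_continuousAt.2 fun s => (hQd s).continuousAt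
  have hEc : Continuous fun t => exp (Q t) := continuous_exp.comp hQc
  have hle : ∀ s < b, ∀ t ≤ s, exp (Q t) ≤
      exp (Q s - M * exp (-κ * s) * s) * exp (M * exp (-κ * s) * t) := by
    intro s hs t hts
    rw [← exp_add]
    refine exp_le_exp.2 ?_
    have hmono : MonotoneOn (fun t => Q t - M * exp (-κ * s) * t) (Iic s) := by
      refine monotoneOn_of_hasDerivWithinAt_nonneg (f' := fun t => P t - M * exp (-κ * s))
        (convex_Iic s) (by fun_prop) (fun x _ => ?_) (fun x hx => ?_)
      · have h := ((hQd x).sub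
          ((hasDerivAt_id x).const_mul (M * exp (-κ * s)))).hasDerivWithinAt (s := interior (Iic s))
        rw [mul_one] at h
        exact h
      · rw [interior_Iic] at hx
        have h1 : exp (-κ * s) ≤ exp (-κ * x) := exp_le_exp.2 (by nlinarith [mem_Iio.1 hx])
        have := hPM x (lt_trans hx hs)
        have := mul_le_mul_of_nonneg_left h1 hM.le
        linarith
    have := hmono (mem_Iic.2 hts) (mem_Iic.2 le_rfl) hts
    simp only at this
    linarith
  have hpos : ∀ s, 0 < M * exp (-κ * s) := fun s => by positivity
  have hint : ∀ s < b, IntegrableOn (fun t => exp (Q t)) (Iic s) := by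
    intro s hs
    refine Integrable.mono' ((integrableOn_exp_mul_Iic (hpos s) s).const_mul
      (exp (Q s - M * exp (-κ * s) * s))) hEc.aestronglyMeasurable ?_
    refine (ae_restrict_iff' measurableSet_Iic).2 (Eventually.of_forall fun t ht => ?_)
    rw [norm_of_nonneg (exp_pos _).le]
    exact hle s hs t ht
  refine ⟨fun s => c * (exp (-Q s) * ∫ t in Iio s, exp (Q t)), fun s hs => ⟨?_, ?_, ?_⟩⟩
  · obtain ⟨s', hs1, hs2⟩ := exists_between hs
    have h1 := hasDerivAt_integral_Iio hEc ((hint s' hs2).mono_set Iio_subset_Iic_self) hs1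
    have h2 := ((hQd s).neg.exp.mul h1).const_mul c
    refine h2.congr_deriv ?_
    have : exp (-Q s) * exp (Q s) = 1 := by rw [← exp_add]; simp
    simp only [Pi.neg_apply]
    linear_combination c * this
  · have : 0 < ∫ t in Iio s, exp (Q t) := by
      rw [← integral_Iic_eq_integral_Iio]
      refine (setIntegral_pos_iff_support_of_nonneg_ae
        (Eventually.of_forall fun t => (exp_pos _).le) (hint s hs)).2 ?_
      have : Function.support (fun t => exp (Q t)) = univ := by
        ext t; simp [(exp_pos _).ne']
      rw [this]; simp
    positivity
  · beta_reduce
    rw [← integral_Iic_eq_integral_Iio]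
    have h1 : ∫ t in Iic s, exp (Q t) ≤ exp (Q s) / (M * exp (-κ * s)) := by
      calc ∫ t in Iic s, exp (Q t)
          ≤ ∫ t in Iic s, exp (Q s - M * exp (-κ * s) * s) * exp (M * exp (-κ * s) * t) :=
            setIntegral_mono_on (hint s hs)
              ((integrableOn_exp_mul_Iic (hpos s) s).const_mul _) measurableSet_Iic (hle s hs)
        _ = exp (Q s) / (M * exp (-κ * s)) := by
            rw [integral_const_mul, integral_exp_mul_Iic (hpos s), mul_div_assoc', ← exp_add]
            simp
    calc c * (exp (-Q s) * ∫ t in Iic s, exp (Q t))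
        ≤ c * (exp (-Q s) * (exp (Q s) / (M * exp (-κ * s)))) := by gcongr
      _ = c / M * exp (κ * s) := by
          rw [neg_mul, exp_neg, exp_neg]
          field_simp

lemma abs_exp_sub_exp_le_s5 {a b R : ℝ} (ha : a ≤ R) (hb : b ≤ R) :
    |exp a - exp b| ≤ exp R * |a - b| := by
  wlog h : b ≤ a generalizing a b
  · rw [abs_sub_comm, abs_sub_comm a b]
    exact this hb ha (le_of_not_ge h)
  rw [abs_of_nonneg (sub_nonneg.2 (exp_le_exp.2 h)), abs_of_nonneg (sub_nonneg.2 h)]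
  have h1 : exp b = exp a * exp (b - a) := by rw [← exp_add]; ring_nf
  have h2 := add_one_le_exp (b - a)
  have h3 := exp_le_exp.2 ha
  calc exp a - exp b = exp a * (1 - exp (b - a)) := by rw [h1]; ring
    _ ≤ exp a * (a - b) := mul_le_mul_of_nonneg_left (by linarith) (exp_pos a).le
    _ ≤ exp R * (a - b) := mul_le_mul_of_nonneg_right h3 (by linarith)

/-- The damping coefficient of the equation `z' + damping z * z = C2` for `z`. -/
noncomputable def damping (A m L κ : ℝ) (z : ℝ → ℝ) (s : ℝ) : ℝ :=
  A + m * z s + L * exp (-κ * s) * exp ((1 - m) * ∫ ρ in Iio s, z ρ)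

lemma integral_Iio_le_of_le_exp {f : ℝ → ℝ} {D κ s : ℝ} (hκ : 0 < κ)
    (hf : IntegrableOn f (Iio s)) (h : ∀ t < s, f t ≤ D * exp (κ * t)) :
    ∫ t in Iio s, f t ≤ D * exp (κ * s) / κ := by
  calc ∫ t in Iio s, f t ≤ ∫ t in Iio s, D * exp (κ * t) :=
        setIntegral_mono_on hf (((integrableOn_exp_mul_Iic hκ s).mono_set
          Iio_subset_Iic_self).const_mul D) measurableSet_Iio h
    _ = D * exp (κ * s) / κ := by
        rw [← integral_Iic_eq_integral_Iio, integral_const_mul, integral_exp_mul_Iic hκ]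
        ring

lemma le_damping {A m L κ M b : ℝ} {z : ℝ → ℝ} (hm0 : 0 < m) (hm1 : m < 1) (hL : 0 < L)
    (hMb : ∀ s < b, M * exp (-κ * s) ≤ A + L * exp (-κ * s)) (hz : ∀ s < b, 0 ≤ z s) :
    ∀ s < b, M * exp (-κ * s) ≤ damping A m L κ z s := by
  intro s hs
  have h0 : 0 ≤ ∫ ρ in Iio s, z ρ :=
    setIntegral_nonneg measurableSet_Iio fun t ht => hz t (lt_trans ht hs)
  have h1 : 1 ≤ exp ((1 - m) * ∫ ρ in Iio s, z ρ) :=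
    one_le_exp (mul_nonneg (by linarith) h0)
  have h2 : L * exp (-κ * s) * 1 ≤ L * exp (-κ * s) * exp ((1 - m) * ∫ ρ in Iio s, z ρ) := by
    gcongr
  have h3 := mul_nonneg hm0.le (hz s hs)
  have := hMb s hs
  unfold damping
  linarith

lemma abs_damping_sub_le {A m L κ K b D : ℝ} {z₁ z₂ : ℝ → ℝ} (hm0 : 0 < m) (hm1 : m < 1)
    (hL : 0 < L) (hκ : 0 < κ) (hb : b ≤ 0) (hK : 0 ≤ K)
    (hi₁ : ∀ s < b, IntegrableOn z₁ (Iio s)) (hi₂ : ∀ s < b, IntegrableOn z₂ (Iio s))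
    (hz₁ : ∀ s < b, z₁ s ≤ K * exp (κ * s)) (hz₂ : ∀ s < b, z₂ s ≤ K * exp (κ * s))
    (hD : ∀ s < b, |z₁ s - z₂ s| ≤ D * exp (κ * s)) {s : ℝ} (hs : s < b) :
    |damping A m L κ z₁ s - damping A m L κ z₂ s| ≤ (m + L * exp (K / κ) / κ) * D := by
  have hes : exp (κ * s) ≤ 1 := exp_le_one_iff.2 (by nlinarith)
  have hD0 : 0 ≤ D := by
    have := (abs_nonneg _).trans (hD s hs)
    exact nonneg_of_mul_nonneg_left this (exp_pos _)
  have hR : ∀ z : ℝ → ℝ, IntegrableOn z (Iio s) → (∀ s < b, z s ≤ K * exp (κ * s)) →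
      (1 - m) * ∫ ρ in Iio s, z ρ ≤ K / κ := by
    intro z hi hz
    have h1 := integral_Iio_le_of_le_exp hκ hi fun t ht => hz t (ht.trans hs)
    have h2 : K * exp (κ * s) / κ ≤ K / κ := by
      gcongr; nlinarith
    have h3 : 0 ≤ K / κ := by positivity
    nlinarith
  have hI : |∫ ρ in Iio s, z₁ ρ - z₂ ρ| ≤ D * exp (κ * s) / κ :=
    abs_integral_le_integral_abs.trans (integral_Iio_le_of_le_exp hκ
      ((hi₁ s hs).sub (hi₂ s hs)).abs fun t ht => hD t (ht.trans hs))
  rw [integral_sub (hi₁ s hs) (hi₂ s hs)] at hI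
  have hexp := abs_exp_sub_exp_le_s5 (hR z₁ (hi₁ s hs) hz₁) (hR z₂ (hi₂ s hs) hz₂)
  rw [← mul_sub, abs_mul, abs_of_pos (by linarith : 0 < 1 - m)] at hexp
  have hE : exp (-κ * s) * exp (κ * s) = 1 := by rw [← exp_add]; simp
  have hA : |m * (z₁ s - z₂ s)| ≤ m * D := by
    rw [abs_mul, abs_of_pos hm0]
    gcongr
    exact (hD s hs).trans (by nlinarith)
  have hB : |L * exp (-κ * s) * (exp ((1 - m) * ∫ ρ in Iio s, z₁ ρ)
      - exp ((1 - m) * ∫ ρ in Iio s, z₂ ρ))| ≤ L * exp (K / κ) / κ * D := by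
    rw [abs_mul, abs_of_pos (by positivity : 0 < L * exp (-κ * s))]
    calc _ ≤ L * exp (-κ * s) * (exp (K / κ) * (1 * (D * exp (κ * s) / κ))) := by
          refine mul_le_mul_of_nonneg_left (hexp.trans ?_) (by positivity)
          gcongr
          linarith
      _ = L * exp (K / κ) / κ * D := by
          linear_combination (L * exp (K / κ) / κ * D) * hE
  unfold damping
  calc _ = |m * (z₁ s - z₂ s) + L * exp (-κ * s) * (exp ((1 - m) * ∫ ρ in Iio s, z₁ ρ)
      - exp ((1 - m) * ∫ ρ in Iio s, z₂ ρ))| := by congr 1; ring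
    _ ≤ _ := (abs_add_le _ _).trans (by linarith)

lemma tendsto_exp_mul_atBot {κ : ℝ} (hκ : 0 < κ) :
    Tendsto (fun s => exp (κ * s)) atBot (nhds 0) :=
  tendsto_exp_atBot.comp (tendsto_id.const_mul_atBot hκ)

lemma abs_sub_le_of_linear {P₁ P₂ y₁ y₂ : ℝ → ℝ} {c M κ K G b : ℝ} (hκ : 0 < κ) (hM : 0 < M)
    (hG : 0 ≤ G) (hK : 0 ≤ K)
    (hP : ∀ s < b, M * exp (-κ * s) ≤ P₁ s) (hPd : ∀ s < b, |P₁ s - P₂ s| ≤ G)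
    (hy₁ : ∀ s < b, HasDerivAt y₁ (c - P₁ s * y₁ s) s)
    (hy₂ : ∀ s < b, HasDerivAt y₂ (c - P₂ s * y₂ s) s)
    (hb₁ : ∀ s < b, 0 ≤ y₁ s ∧ y₁ s ≤ K * exp (κ * s))
    (hb₂ : ∀ s < b, 0 ≤ y₂ s ∧ y₂ s ≤ K * exp (κ * s)) :
    ∀ s < b, |y₁ s - y₂ s| ≤ G * K / M * exp (2 * κ * s) := by
  have hlim : ∀ y : ℝ → ℝ, (∀ s < b, 0 ≤ y s ∧ y s ≤ K * exp (κ * s)) →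
      Tendsto y atBot (nhds 0) := by
    intro y hy
    refine tendsto_of_tendsto_of_tendsto_of_le_of_le' tendsto_const_nhds
      (by simpa using (tendsto_exp_mul_atBot hκ).const_mul K) ?_ ?_
    · filter_upwards [eventually_lt_atBot b] with s hs using (hy s hs).1
    · filter_upwards [eventually_lt_atBot b] with s hs using (hy s hs).2
  have hlim2 : Tendsto (fun s => G * K / M * exp (2 * κ * s)) atBot (nhds 0) := by
    simpa using (tendsto_exp_mul_atBot (κ := 2 * κ) (by positivity)).const_mul (G * K / M)
  have hexp : ∀ s, HasDerivAt (fun s => G * K / M * exp (2 * κ * s))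
      (G * K / M * (exp (2 * κ * s) * (2 * κ))) s := fun s => by
    simpa using ((hasDerivAt_id s).const_mul (2 * κ)).exp.const_mul (G * K / M)
  have hgain : ∀ σ : ℝ, |σ| = 1 → ∀ s < b,
      0 < σ * (y₁ s - y₂ s) - G * K / M * exp (2 * κ * s) →
      σ * ((c - P₁ s * y₁ s) - (c - P₂ s * y₂ s))
        - G * K / M * (exp (2 * κ * s) * (2 * κ)) ≤ 0 := by
    intro σ hσ s hs hpos
    have h1 : G * K * exp (κ * s) ≤ P₁ s * (σ * (y₁ s - y₂ s)) := by
      have he : exp (-κ * s) * exp (2 * κ * s) = exp (κ * s) := by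
        rw [← exp_add]; ring_nf
      calc G * K * exp (κ * s)
          = M * exp (-κ * s) * (G * K / M * exp (2 * κ * s)) := by
            rw [← he]; field_simp
        _ ≤ P₁ s * (σ * (y₁ s - y₂ s)) := by
            refine mul_le_mul (hP s hs) (by linarith) (by positivity) ?_
            exact (by positivity : 0 ≤ M * exp (-κ * s)).trans (hP s hs)
    have h2 : -(σ * (P₁ s - P₂ s) * y₂ s) ≤ G * K * exp (κ * s) := by
      refine (neg_le_abs _).trans ?_
      rw [abs_mul, abs_mul, hσ, one_mul, abs_of_nonneg (hb₂ s hs).1, mul_assoc]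
      exact mul_le_mul (hPd s hs) (hb₂ s hs).2 (hb₂ s hs).1 hG
    have h3 : 0 ≤ G * K / M * (exp (2 * κ * s) * (2 * κ)) := by positivity
    linarith
  have hmain : ∀ σ : ℝ, |σ| = 1 → ∀ s < b,
      σ * (y₁ s - y₂ s) - G * K / M * exp (2 * κ * s) ≤ 0 := fun σ hσ =>
    nonpos_of_tendsto_atBot_of_deriv_nonpos
      (fun s hs => (((hy₁ s hs).sub (hy₂ s hs)).const_mul σ).sub (hexp s))
      (by simpa using (((hlim y₁ hb₁).sub (hlim y₂ hb₂)).const_mul σ).sub hlim2) (hgain σ hσ)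
  intro s hs
  have h1 := hmain 1 (by simp) s hs
  have h2 := hmain (-1) (by simp) s hs
  exact abs_le.2 ⟨by linarith, by linarith⟩

/-- The solution map `z ↦ y` of `y' = c - damping z * y` halves the weighted distance. -/
lemma abs_sub_le_half {A m L κ K M c b D : ℝ} {z₁ z₂ y₁ y₂ : ℝ → ℝ} (hm0 : 0 < m) (hm1 : m < 1)
    (hL : 0 < L) (hκ : 0 < κ) (hb : b ≤ 0) (hK : 0 ≤ K) (hM : 0 < M)
    (hMb : ∀ s < b, M * exp (-κ * s) ≤ A + L * exp (-κ * s))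
    (hsmall : ∀ s < b, (m + L * exp (K / κ) / κ) * K * exp (κ * s) ≤ M / 2)
    (hi₁ : ∀ s < b, IntegrableOn z₁ (Iio s)) (hi₂ : ∀ s < b, IntegrableOn z₂ (Iio s))
    (hz₁ : ∀ s < b, 0 ≤ z₁ s ∧ z₁ s ≤ K * exp (κ * s))
    (hz₂ : ∀ s < b, 0 ≤ z₂ s ∧ z₂ s ≤ K * exp (κ * s))
    (hy₁ : ∀ s < b, HasDerivAt y₁ (c - damping A m L κ z₁ s * y₁ s) s)
    (hy₂ : ∀ s < b, HasDerivAt y₂ (c - damping A m L κ z₂ s * y₂ s) s)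
    (hb₁ : ∀ s < b, 0 ≤ y₁ s ∧ y₁ s ≤ K * exp (κ * s))
    (hb₂ : ∀ s < b, 0 ≤ y₂ s ∧ y₂ s ≤ K * exp (κ * s)) (hD0 : 0 ≤ D)
    (hD : ∀ s < b, |z₁ s - z₂ s| ≤ D * exp (κ * s)) :
    ∀ s < b, |y₁ s - y₂ s| ≤ D / 2 * exp (κ * s) := by
  intro s hs
  refine (abs_sub_le_of_linear hκ hM (by positivity : 0 ≤ (m + L * exp (K / κ) / κ) * D) hK
    (le_damping hm0 hm1 hL hMb fun s hs => (hz₁ s hs).1)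
    (fun s hs => abs_damping_sub_le hm0 hm1 hL hκ hb hK hi₁ hi₂ (fun s hs => (hz₁ s hs).2)
      (fun s hs => (hz₂ s hs).2) hD hs) hy₁ hy₂ hb₁ hb₂ s hs).trans ?_
  have he : exp (2 * κ * s) = exp (κ * s) * exp (κ * s) := by rw [← exp_add]; ring_nf
  calc (m + L * exp (K / κ) / κ) * D * K / M * exp (2 * κ * s)
      = ((m + L * exp (K / κ) / κ) * K * exp (κ * s)) * (D * exp (κ * s) / M) := by
        rw [he]; ring
    _ ≤ M / 2 * (D * exp (κ * s) / M) := by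
        gcongr
        exact hsmall s hs
    _ = D / 2 * exp (κ * s) := by field_simp

/-- Solutions of `z' = c - damping z * z` trapped between `0` and `K e^{κ s}` are unique. -/
lemma eqOn_of_damped {A m L κ K M c b : ℝ} {z₁ z₂ : ℝ → ℝ} (hm0 : 0 < m) (hm1 : m < 1)
    (hL : 0 < L) (hκ : 0 < κ) (hb : b ≤ 0) (hK : 0 ≤ K) (hM : 0 < M)
    (hMb : ∀ s < b, M * exp (-κ * s) ≤ A + L * exp (-κ * s))
    (hsmall : ∀ s < b, (m + L * exp (K / κ) / κ) * K * exp (κ * s) ≤ M / 2)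
    (hi₁ : ∀ s < b, IntegrableOn z₁ (Iio s)) (hi₂ : ∀ s < b, IntegrableOn z₂ (Iio s))
    (hz₁ : ∀ s < b, 0 ≤ z₁ s ∧ z₁ s ≤ K * exp (κ * s))
    (hz₂ : ∀ s < b, 0 ≤ z₂ s ∧ z₂ s ≤ K * exp (κ * s))
    (hd₁ : ∀ s < b, HasDerivAt z₁ (c - damping A m L κ z₁ s * z₁ s) s)
    (hd₂ : ∀ s < b, HasDerivAt z₂ (c - damping A m L κ z₂ s * z₂ s) s) :
    EqOn z₁ z₂ (Iio b) := by
  have hiter : ∀ k : ℕ, ∀ s < b, |z₁ s - z₂ s| ≤ K * (1 / 2) ^ k * exp (κ * s) := by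
    intro k
    induction k with
    | zero =>
      intro s hs
      have h1 := hz₁ s hs
      have h2 := hz₂ s hs
      rw [pow_zero, mul_one]
      exact abs_le.2 ⟨by linarith, by linarith⟩
    | succ k ih =>
      intro s hs
      refine (abs_sub_le_half hm0 hm1 hL hκ hb hK hM hMb hsmall hi₁ hi₂ hz₁ hz₂ hd₁ hd₂ hz₁ hz₂
        (by positivity) ih s hs).trans_eq ?_
      ring
  intro s hs
  have hlim : Tendsto (fun k : ℕ => K * (1 / 2) ^ k * exp (κ * s)) atTop (nhds 0) := by
    simpa using ((tendsto_pow_atTop_nhds_zero_of_lt_one (r := (1 / 2 : ℝ)) (by norm_num)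
      (by norm_num)).const_mul K).mul_const (exp (κ * s))
  have := ge_of_tendsto' hlim fun k => hiter k s hs
  exact sub_eq_zero.1 (abs_eq_zero.1 (le_antisymm this (abs_nonneg _)))

lemma continuous_damping {A m L κ : ℝ} {z : ℝ → ℝ} (hz : Continuous z)
    (hi : ∀ s, IntegrableOn z (Iio s)) : Continuous (damping A m L κ z) := by
  have hI : Continuous fun s => ∫ ρ in Iio s, z ρ := continuous_iff_continuousAt.2 fun s =>
    (hasDerivAt_integral_Iio hz (hi (s + 1)) (by linarith)).continuousAt
  unfold damping
  fun_prop

/-- Existence of a solution of `z' = c - damping z * z` trapped between `0` and `K e^{κ s}`. -/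
lemma exists_damped_solution {A m L κ K M c b b' : ℝ} (hm0 : 0 < m) (hm1 : m < 1)
    (hL : 0 < L) (hκ : 0 < κ) (hb : b ≤ 0) (hK : 0 < K) (hM : 0 < M) (hc : c = K * M)
    (hMb : ∀ s < b, M * exp (-κ * s) ≤ A + L * exp (-κ * s))
    (hsmall : ∀ s < b, (m + L * exp (K / κ) / κ) * K * exp (κ * s) ≤ M / 2) (hb' : b' < b) :
    ∃ z : ℝ → ℝ, Continuous z ∧ (∀ s, IntegrableOn z (Iio s)) ∧
      (∀ s < b', 0 < z s ∧ z s ≤ K * exp (κ * s)) ∧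
      ∀ s < b', HasDerivAt z (c - damping A m L κ z s * z s) s := by
  let S : Set (BoundedContinuousFunction ℝ ℝ) := {v | ∀ s, 0 ≤ v s ∧ v s ≤ K}
  have hS : IsClosed S := by
    simp only [S, ofPred_forall, ofPred_and]
    exact isClosed_iInter fun s =>
      (isClosed_le continuous_const (continuous_eval_const s)).inter
        (isClosed_le (continuous_eval_const s) continuous_const)
  let ζ : S → ℝ → ℝ := fun v s => v.1 s * exp (κ * s)
  have hζc : ∀ v, Continuous (ζ v) := fun v => by
    have := v.1.continuous
    simp only [ζ]; fun_prop
  have hζb : ∀ v s, 0 ≤ ζ v s ∧ ζ v s ≤ K * exp (κ * s) := fun v s =>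
    ⟨mul_nonneg (v.2 s).1 (exp_pos _).le,
      mul_le_mul_of_nonneg_right (v.2 s).2 (exp_pos _).le⟩
  have hζi : ∀ v s, IntegrableOn (ζ v) (Iio s) := fun v s => by
    refine Integrable.mono' (((integrableOn_exp_mul_Iic hκ s).mono_set
      Iio_subset_Iic_self).const_mul K) (hζc v).aestronglyMeasurable
      (Eventually.of_forall fun t => ?_)
    rw [norm_of_nonneg (hζb v t).1]
    exact (hζb v t).2
  have hcM : c / M = K := by rw [hc]; field_simp
  have hsol := fun v : S => exists_linear_solution (continuous_damping (hζc v) (hζi v))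
    (by rw [hc]; positivity : 0 < c) hM hκ
    (le_damping hm0 hm1 hL hMb fun s _ => (hζb v s).1)
  simp only [hcM] at hsol
  choose y hy using hsol
  have hmin : ∀ s, min s b' < b := fun s => (min_le_right _ _).trans_lt hb'
  have hTb : ∀ v s, 0 ≤ y v (min s b') * exp (-κ * min s b') ∧
      y v (min s b') * exp (-κ * min s b') ≤ K := fun v s => by
    obtain ⟨-, h1, h2⟩ := hy v _ (hmin s)
    have he : exp (κ * min s b') * exp (-κ * min s b') = 1 := by rw [← exp_add]; simp
    refine ⟨by positivity, ?_⟩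
    calc _ ≤ K * exp (κ * min s b') * exp (-κ * min s b') := by gcongr
      _ = K := by rw [mul_assoc, he, mul_one]
  have hTc : ∀ v, Continuous fun s => y v (min s b') * exp (-κ * min s b') := fun v => by
    refine Continuous.mul ?_ (by fun_prop)
    refine continuous_iff_continuousAt.2 fun s => ?_
    exact ContinuousAt.comp (f := fun s => min s b') (hy v _ (hmin s)).1.continuousAt
      (by fun_prop)
  let T : S → S := fun v => ⟨BoundedContinuousFunction.ofNormedAddCommGroup _ (hTc v) K
    (fun s => by rw [norm_of_nonneg (hTb v s).1]; exact (hTb v s).2), fun s => hTb v s⟩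
  have hT : ContractingWith (1 / 2) T := by
    refine ⟨by rw [← NNReal.coe_lt_coe]; norm_num, LipschitzWith.of_dist_le_mul fun v₁ v₂ => ?_⟩
    rw [Subtype.dist_eq, BoundedContinuousFunction.dist_le (by positivity)]
    intro s
    have hdist : ∀ s < b, |ζ v₁ s - ζ v₂ s| ≤ dist v₁ v₂ * exp (κ * s) := fun s _ => by
      simp only [ζ]
      rw [← sub_mul, abs_mul, abs_of_pos (exp_pos _)]
      gcongr
      exact BoundedContinuousFunction.dist_coe_le_dist (f := v₁.1) (g := v₂.1) s
    have h := abs_sub_le_half hm0 hm1 hL hκ hb hK.le hM hMb hsmall (fun s _ => hζi v₁ s)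
      (fun s _ => hζi v₂ s) (fun s _ => hζb v₁ s) (fun s _ => hζb v₂ s)
      (fun s hs => (hy v₁ s hs).1) (fun s hs => (hy v₂ s hs).1)
      (fun s hs => ⟨(hy v₁ s hs).2.1.le, (hy v₁ s hs).2.2⟩)
      (fun s hs => ⟨(hy v₂ s hs).2.1.le, (hy v₂ s hs).2.2⟩) dist_nonneg hdist _ (hmin s)
    have he : exp (κ * min s b') * exp (-κ * min s b') = 1 := by rw [← exp_add]; simp
    change |y v₁ (min s b') * exp (-κ * min s b') - y v₂ (min s b') * exp (-κ * min s b')| ≤ _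
    rw [← sub_mul, abs_mul, abs_of_pos (exp_pos (-κ * min s b'))]
    calc _ ≤ dist v₁ v₂ / 2 * exp (κ * min s b') * exp (-κ * min s b') := by gcongr
      _ = dist v₁ v₂ / 2 := by rw [mul_assoc, he, mul_one]
      _ = _ := by push_cast; ring
  have : CompleteSpace S := hS.completeSpace_coe
  have : Nonempty S := ⟨⟨0, fun s => ⟨le_rfl, hK.le⟩⟩⟩
  obtain ⟨v, hv⟩ : ∃ v, T v = v := ⟨_, hT.fixedPoint_isFixedPt⟩
  have heq : ∀ s ≤ b', ζ v s = y v s := fun s hs => by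
    have h1 : v.1 s = y v (min s b') * exp (-κ * min s b') :=
      (DFunLike.congr_fun (congrArg Subtype.val hv) s).symm
    have he : exp (-κ * s) * exp (κ * s) = 1 := by rw [← exp_add]; simp
    simp only [ζ]
    rw [h1, min_eq_left hs, mul_assoc, he, mul_one]
  refine ⟨ζ v, hζc v, hζi v, fun s hs => ⟨?_, (hζb v s).2⟩, fun s hs => ?_⟩
  · rw [heq s hs.le]
    exact (hy v s (hs.trans hb')).2.1
  · rw [heq s hs.le]
    refine (hy v s (hs.trans hb')).1.congr_of_eventuallyEq ?_
    filter_upwards [Iio_mem_nhds hs] with t ht using heq t (le_of_lt ht)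

/-- `ZODE` as a damped equation `z' = c - damping z * z`. -/
lemma zode_iff {n : ℕ} {m ρ1 η β α C4 b1 : ℝ} {z : ℝ → ℝ} (hη : 0 < η) :
    ZODE n m ρ1 η β α C4 b1 z ↔
      ContDiffOn ℝ 1 z (Iio (-b1)) ∧ (∀ s < -b1, IntegrableOn z (Iio s)) ∧
      (∀ s < -b1, HasDerivAt z (α / β * ((n : ℝ) - 2 - m * α / β) -
        damping ((n : ℝ) - 2 - 2 * m * α / β) m (β * η ^ (1 - m)) (ρ1 / β) z s * z s) s) ∧
      ∀ s < -b1, 0 < z s ∧ z s ≤ C4 * η ^ (m - 1) * exp (ρ1 / β * s) := by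
  unfold ZODE
  refine and_congr_right fun hC => and_congr_right fun _ => and_congr ?_ ?_
  · refine forall₂_congr fun s hs => ?_
    have hdiff : HasDerivAt z (deriv z s) s :=
      ((hC.differentiableOn one_ne_zero).differentiableAt (Iio_mem_nhds hs)).hasDerivAt
    have hpow : (η * exp (∫ ρ in Iio s, z ρ)) ^ (1 - m) =
        η ^ (1 - m) * exp ((1 - m) * ∫ ρ in Iio s, z ρ) := by
      rw [mul_rpow hη.le (exp_pos _).le, ← exp_mul, mul_comm (1 - m)]
    rw [hpow]
    constructor
    · intro h
      convert hdiff using 1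
      unfold damping
      linear_combination -h
    · intro h
      rw [h.deriv]
      unfold damping
      ring
  · refine forall₂_congr fun s hs => and_congr (mul_pos_iff_of_pos_right (exp_pos _)) ?_
    rw [neg_mul, exp_neg, ← div_eq_mul_inv, div_le_iff₀ (exp_pos _)]

theorem stmt5 (n : ℕ) (m ρ1 η β α C1 C2 C3 C4 : ℝ)
    (hn : 3 ≤ n) (hm0 : 0 < m) (hm1 : m < ((n : ℝ) - 2) / (n : ℝ))
    (hρ1 : 0 < ρ1) (hη : 0 < η)
    (hβ : m * ρ1 / ((n : ℝ) - 2 - (n : ℝ) * m) < β)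
    (hα : α = (2 * β + ρ1) / (1 - m))
    (hC1 : C1 = 1 / (2 * m) * ((n : ℝ) - 2 - 2 * m * α / β))
    (hC2 : C2 = α / β * ((n : ℝ) - 2 - m * α / β))
    (hC3 : C3 = C2 + m * C1 ^ 2)
    (hC4 : C4 = C3 / β) :
    ∃ b1 : ℝ, 0 < b1 ∧
      ∃ z : ℝ → ℝ, ZODE n m ρ1 η β α C4 b1 z ∧
        ∀ z' : ℝ → ℝ, ZODE n m ρ1 η β α C4 b1 z' →
          Set.EqOn z' z (Set.Iio (-b1)) := by
  have hn' : (3 : ℝ) ≤ n := by exact_mod_cast hn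
  have hn0 : (0 : ℝ) < n := by linarith
  have hnm : 0 < (n : ℝ) - 2 - n * m := by
    have := (lt_div_iff₀ hn0).1 hm1
    linarith
  have hm1' : m < 1 := by nlinarith
  have hβ0 : 0 < β := lt_of_le_of_lt (by positivity) hβ
  have hα0 : 0 < α := by
    rw [hα]
    exact div_pos (by positivity) (by linarith)
  have hmρ : m * ρ1 < β * ((n : ℝ) - 2 - n * m) := (div_lt_iff₀ hnm).1 hβ
  have hαm : α * (1 - m) = 2 * β + ρ1 := by
    rw [hα, div_mul_cancel₀]
    linarith
  have hgap : 0 < (n : ℝ) - 2 - m * α / β := by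
    rw [sub_pos, div_lt_iff₀ hβ0]
    nlinarith
  have hC2' : 0 < C2 := by rw [hC2]; positivity
  have hC3' : 0 < C3 := by rw [hC3]; positivity
  have hκ : 0 < ρ1 / β := by positivity
  have hL : 0 < β * η ^ (1 - m) := by positivity
  set κ := ρ1 / β
  set L := β * η ^ (1 - m) with hLdef
  set A := (n : ℝ) - 2 - 2 * m * α / β
  have hK0 : C4 * η ^ (m - 1) = C3 / L := by
    rw [hC4, hLdef, show m - 1 = -(1 - m) by ring, rpow_neg hη.le]
    field_simp
  set K := C4 * η ^ (m - 1)
  have hK : 0 < K := by rw [hK0]; positivity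
  set M := L * C2 / C3 with hMdef
  have hM : 0 < M := by positivity
  have hKM : C2 = K * M := by rw [hK0, hMdef]; field_simp
  have hev1 : ∀ᶠ s in atBot, M * exp (-κ * s) ≤ A + L * exp (-κ * s) := by
    rcases le_or_gt 0 A with hA | hA
    · refine Eventually.of_forall fun s => ?_
      have hML : M ≤ L := by
        rw [hMdef, div_le_iff₀ hC3']
        have : C2 ≤ C3 := by rw [hC3]; nlinarith [mul_nonneg hm0.le (sq_nonneg C1)]
        gcongr
      have := mul_le_mul_of_nonneg_right hML (exp_pos (-κ * s)).le
      linarith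
    · have hC1' : C1 < 0 := by
        rw [hC1]
        exact mul_neg_of_pos_of_neg (by positivity) hA
      have hML : 0 < L - M := by
        rw [hMdef, sub_pos, div_lt_iff₀ hC3']
        have : C2 < C3 := by rw [hC3]; nlinarith [mul_pos hm0 (sq_pos_of_neg hC1')]
        gcongr
      have hlim : Tendsto (fun s => (L - M) * exp (-κ * s)) atBot atTop :=
        (tendsto_exp_atTop.comp
          (tendsto_id.const_mul_atBot_of_neg (neg_lt_zero.2 hκ))).const_mul_atTop hML
      filter_upwards [hlim.eventually_ge_atTop (-A)] with s hs
      linarith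
  have hev2 : ∀ᶠ s in atBot, (m + L * exp (K / κ) / κ) * K * exp (κ * s) ≤ M / 2 := by
    have hlim : Tendsto (fun s => (m + L * exp (K / κ) / κ) * K * exp (κ * s)) atBot (nhds 0) := by
      simpa using (tendsto_exp_mul_atBot hκ).const_mul ((m + L * exp (K / κ) / κ) * K)
    exact hlim.eventually (ge_mem_nhds (half_pos hM))
  obtain ⟨b₀, hb₀⟩ := eventually_atBot.1 (hev1.and hev2)
  set b := min b₀ 0
  have hb0 : b ≤ 0 := min_le_right _ _
  have hMb : ∀ s < b, M * exp (-κ * s) ≤ A + L * exp (-κ * s) := fun s hs =>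
    (hb₀ s (hs.le.trans (min_le_left _ _))).1
  have hsmall : ∀ s < b, (m + L * exp (K / κ) / κ) * K * exp (κ * s) ≤ M / 2 := fun s hs =>
    (hb₀ s (hs.le.trans (min_le_left _ _))).2
  have hb1 : -(1 - b) < b := by linarith
  obtain ⟨z, hzc, hzi, hzb, hzd⟩ :=
    exists_damped_solution hm0 hm1' hL hκ hb0 hK hM hKM hMb hsmall hb1
  refine ⟨1 - b, by linarith, z, (zode_iff hη).2 ⟨?_, fun s _ => hzi s, ?_, hzb⟩, fun z' hz' => ?_⟩
  · rw [contDiffOn_one_iff_derivWithin (uniqueDiffOn_Iio _)]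
    refine ⟨fun s hs => (hzd s hs).differentiableAt.differentiableWithinAt, ?_⟩
    have hcont : Continuous fun s => C2 - damping A m L κ z s * z s :=
      continuous_const.sub ((continuous_damping hzc hzi).mul hzc)
    refine hcont.continuousOn.congr fun s hs => ?_
    rw [derivWithin_of_isOpen isOpen_Iio hs, (hzd s hs).deriv]
  · rw [← hC2]
    exact hzd
  · obtain ⟨-, hi', hd', hb'⟩ := (zode_iff hη).1 hz'
    rw [← hC2] at hd'
    exact eqOn_of_damped hm0 hm1' hL hκ (hb1.le.trans hb0) hK.le hM
      (fun s hs => hMb s (hs.trans hb1)) (fun s hs => hsmall s (hs.trans hb1))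
      hi' (fun s _ => hzi s) (fun s hs => ⟨(hb' s hs).1.le, (hb' s hs).2⟩)
      (fun s hs => ⟨(hzb s hs).1.le, (hzb s hs).2⟩) hd' hzd
end

section
/- Let f be a positive function on (0,∞) such that r ↦ f(r)^m/m is twice continuously differentiable on (0,∞), (f^m/m)''(r) + ((n-1)/r)·(f^m/m)'(r) + α·f(r) + β·r·f'(r) = 0 for all r > 0, lim_{r→0+} r^{α/β}·f(r) = η, and, with w(r) = r^{α/β}·f(r) and z(s) = e^s·w'(e^s)/w(e^s), 0 < z(s)·e^{-(ρ1/β)s} ≤ C4·η^{m-1} for all s ∈ ℝ. Then f(r) + (β/α)·r·f'(r) > 0 for all r > 0, and η·r^{-α/β} < f(r) ≤ η·r^{-α/β}·exp((C3·η^{m-1}/ρ1)·r^{ρ1/β}) for all r > 0. -/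
open Real Set Filter

/-- `z(s) = e^s w'(e^s) / w(e^s)` where `w(r) = r^{α/β} f(r)`. -/
noncomputable def Zfun (α β : ℝ) (f : ℝ → ℝ) (s : ℝ) : ℝ :=
  Real.exp s * deriv (fun r => r ^ (α / β) * f r) (Real.exp s) /
    (Real.exp s ^ (α / β) * f (Real.exp s))

/-- the bound `0 < z(s) e^{-(ρ1/β) s} ≤ C4 η^{m-1}` for all `s ∈ ℝ`. -/
def FDEZBound (m α β ρ1 η C4 : ℝ) (f : ℝ → ℝ) : Prop :=
  ∀ s : ℝ, 0 < Zfun α β f s * Real.exp (-(ρ1 / β) * s) ∧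
    Zfun α β f s * Real.exp (-(ρ1 / β) * s) ≤ C4 * η ^ (m - 1)

/-- A function that is strictly increasing on `(0,∞)` stays above its limit at `0+`. -/
theorem lt_of_strictMonoOn_of_tendsto {w : ℝ → ℝ} {l : ℝ} (hw : StrictMonoOn w (Ioi 0))
    (hl : Tendsto w (nhdsWithin 0 (Ioi 0)) (nhds l)) {r : ℝ} (hr : 0 < r) : l < w r := by
  have hr2 : 0 < r / 2 := by positivity
  refine lt_of_le_of_lt (le_of_tendsto hl ?_) (hw hr2 hr (by linarith : r / 2 < r))
  filter_upwards [Ioo_mem_nhdsGT hr2] with x hx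
  exact hw.monotoneOn hx.1 hr2 hx.2.le

/-- A function that is decreasing on `(0,∞)` stays below its limit at `0+`. -/
theorem le_of_antitoneOn_of_tendsto {w : ℝ → ℝ} {l : ℝ} (hw : AntitoneOn w (Ioi 0))
    (hl : Tendsto w (nhdsWithin 0 (Ioi 0)) (nhds l)) {r : ℝ} (hr : 0 < r) : w r ≤ l := by
  refine ge_of_tendsto hl ?_
  filter_upwards [Ioo_mem_nhdsGT hr] with x hx
  exact hw hx.1 hr hx.2.le

/-- A positive function is differentiable wherever `f ^ m / m` is, for `m ≠ 0`. -/
theorem differentiableAt_of_rpow_div {f : ℝ → ℝ} {m r : ℝ} (hm : m ≠ 0)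
    (hpos : ∀ x ∈ Ioi (0 : ℝ), 0 < f x) (hr : 0 < r)
    (hd : DifferentiableAt ℝ (fun x => f x ^ m / m) r) : DifferentiableAt ℝ f r := by
  have hne : m * (f r ^ m / m) ≠ 0 := by
    rw [mul_div_cancel₀ _ hm]
    exact (rpow_pos_of_pos (hpos r hr) m).ne'
  refine ((hd.const_mul m).rpow_const (p := m⁻¹) (Or.inl hne)).congr_of_eventuallyEq ?_
  filter_upwards [Ioi_mem_nhds hr] with x hx
  rw [mul_div_cancel₀ _ hm, rpow_rpow_inv (hpos x hx).le hm]

/-- Grönwall bound on `(0,∞)` for `x w'(x) ≤ c K x ^ c w(x)` with `w(0+) = l`. -/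
theorem le_mul_exp_of_deriv_le {w w' : ℝ → ℝ} {l K c : ℝ} (hc : 0 < c)
    (hw : ∀ x, 0 < x → HasDerivAt w (w' x) x)
    (hbound : ∀ x, 0 < x → w' x ≤ K * (c * x ^ (c - 1)) * w x)
    (hl : Tendsto w (nhdsWithin 0 (Ioi 0)) (nhds l)) {r : ℝ} (hr : 0 < r) :
    w r ≤ l * exp (K * r ^ c) := by
  have hd : ∀ x, 0 < x → HasDerivAt (fun x => w x * exp (-(K * x ^ c)))
      (w' x * exp (-(K * x ^ c)) + w x * (exp (-(K * x ^ c)) * -(K * (c * x ^ (c - 1))))) x :=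
    fun x hx => (hw x hx).mul
      (((hasDerivAt_rpow_const (Or.inl hx.ne')).const_mul K).neg.exp)
  have hanti : AntitoneOn (fun x => w x * exp (-(K * x ^ c))) (Ioi 0) := by
    refine antitoneOn_of_deriv_nonpos (convex_Ioi 0)
      (fun x hx => (hd x hx).continuousAt.continuousWithinAt) ?_ ?_
    · rw [interior_Ioi]
      exact fun x hx => (hd x hx).differentiableAt.differentiableWithinAt
    · rw [interior_Ioi]
      intro x hx
      rw [(hd x hx).deriv]
      nlinarith [mul_le_mul_of_nonneg_right (hbound x hx) (exp_pos (-(K * x ^ c))).le]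
  have hlim : Tendsto (fun x => w x * exp (-(K * x ^ c))) (nhdsWithin 0 (Ioi 0)) (nhds l) := by
    have h0 : Tendsto (fun x : ℝ => exp (-(K * x ^ c))) (nhdsWithin 0 (Ioi 0)) (nhds 1) := by
      have hcont : ContinuousAt (fun x : ℝ => exp (-(K * x ^ c))) 0 :=
        ((continuousAt_rpow_const 0 c (Or.inr hc.le)).const_mul K).neg.rexp
      have := hcont.tendsto.mono_left (nhdsWithin_le_nhds (s := Ioi 0))
      simpa [zero_rpow hc.ne'] using this
    simpa using hl.mul h0
  have h := le_of_antitoneOn_of_tendsto hanti hlim hr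
  have hexp : exp (-(K * r ^ c)) * exp (K * r ^ c) = 1 := by
    rw [← exp_add, neg_add_cancel, exp_zero]
  calc w r = w r * exp (-(K * r ^ c)) * exp (K * r ^ c) := by rw [mul_assoc, hexp, mul_one]
    _ ≤ l * exp (K * r ^ c) := mul_le_mul_of_nonneg_right h (exp_pos _).le

theorem stmt7 (n : ℕ) (m ρ1 η β α C1 C2 C3 C4 : ℝ)
    (hn : 3 ≤ n) (hm0 : 0 < m) (hm1 : m < ((n : ℝ) - 2) / (n : ℝ))
    (hρ1 : 0 < ρ1) (hη : 0 < η)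
    (hβ : m * ρ1 / ((n : ℝ) - 2 - (n : ℝ) * m) < β)
    (hα : α = (2 * β + ρ1) / (1 - m))
    (hC1 : C1 = 1 / (2 * m) * ((n : ℝ) - 2 - 2 * m * α / β))
    (hC2 : C2 = α / β * ((n : ℝ) - 2 - m * α / β))
    (hC3 : C3 = C2 + m * C1 ^ 2)
    (hC4 : C4 = C3 / β)
    (f : ℝ → ℝ) (hf : FDESol n m α β η f) (hz : FDEZBound m α β ρ1 η C4 f) :
    ∀ r ∈ Set.Ioi (0 : ℝ),
      0 < f r + β / α * r * deriv f r ∧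
      η * r ^ (-(α / β)) < f r ∧
      f r ≤ η * r ^ (-(α / β)) *
        Real.exp (C3 * η ^ (m - 1) / ρ1 * r ^ (ρ1 / β)) := by
  obtain ⟨hpos, hcd, -, hlim⟩ := hf
  have hn' : (0 : ℝ) < n := by positivity
  rw [lt_div_iff₀ hn'] at hm1
  have hβ0 : 0 < β := lt_trans (div_pos (mul_pos hm0 hρ1) (by linarith)) hβ
  have hm_lt : m < 1 := by nlinarith
  have hα0 : 0 < α := hα ▸ div_pos (by positivity) (by linarith)
  have hfd : ∀ x, 0 < x → DifferentiableAt ℝ f x := fun x hx =>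
    differentiableAt_of_rpow_div hm0.ne' hpos hx
      ((hcd.differentiableOn two_ne_zero).differentiableAt (Ioi_mem_nhds hx))
  have hwd : ∀ x, 0 < x → HasDerivAt (fun r => r ^ (α / β) * f r)
      (α / β * x ^ (α / β - 1) * f x + x ^ (α / β) * deriv f x) x := fun x hx =>
    (hasDerivAt_rpow_const (Or.inl hx.ne')).mul (hfd x hx).hasDerivAt
  have hwpos : ∀ x, 0 < x → 0 < x ^ (α / β) * f x := fun x hx =>
    mul_pos (rpow_pos_of_pos hx _) (hpos x hx)
  have hderiv : ∀ x, 0 < x → 0 < deriv (fun r => r ^ (α / β) * f r) x ∧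
      deriv (fun r => r ^ (α / β) * f r) x ≤
        C3 * η ^ (m - 1) / ρ1 * (ρ1 / β * x ^ (ρ1 / β - 1)) * (x ^ (α / β) * f x) := by
    intro x hx
    obtain ⟨h1, h2⟩ := hz (log x)
    have hE : exp (-(ρ1 / β) * log x) = (x ^ (ρ1 / β))⁻¹ := by
      rw [rpow_def_of_pos hx, ← exp_neg]
      ring_nf
    have hxc : 0 < x ^ (ρ1 / β) := rpow_pos_of_pos hx _
    have hW := hwpos x hx
    rw [hE, Zfun, exp_log hx, ← div_eq_mul_inv] at h1 h2
    rw [div_div] at h1 h2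
    have hden := mul_pos hW hxc
    rw [div_le_iff₀ hden] at h2
    refine ⟨pos_of_mul_pos_right ((div_pos_iff_of_pos_right hden).1 h1) hx.le, ?_⟩
    refine le_of_mul_le_mul_left (h2.trans_eq ?_) hx
    rw [rpow_sub_one hx.ne', hC4]
    field_simp
  intro r hr
  have hr0 : 0 < r := hr
  have hcancel : r ^ (-(α / β)) * r ^ (α / β) = 1 := by
    rw [← rpow_add hr0, neg_add_cancel, rpow_zero]
  have hneg : 0 < r ^ (-(α / β)) := rpow_pos_of_pos hr0 _
  have hf_eq : f r = r ^ (α / β) * f r * r ^ (-(α / β)) := by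
    linear_combination -f r * hcancel
  refine ⟨?_, ?_, ?_⟩
  · have h := (hderiv r hr0).1
    rw [(hwd r hr0).deriv] at h
    have hfac : α / β * r ^ (α / β - 1) * f r + r ^ (α / β) * deriv f r =
        α / β * r ^ (α / β - 1) * (f r + β / α * r * deriv f r) := by
      rw [rpow_sub_one hr0.ne']
      field_simp
    rw [hfac] at h
    exact pos_of_mul_pos_right h (by positivity)
  · have hmono : StrictMonoOn (fun r => r ^ (α / β) * f r) (Ioi 0) := by
      refine strictMonoOn_of_deriv_pos (convex_Ioi 0)
        (fun x hx => (hwd x hx).continuousAt.continuousWithinAt) ?_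
      rw [interior_Ioi]
      exact fun x hx => (hderiv x hx).1
    rw [hf_eq]
    exact mul_lt_mul_of_pos_right (lt_of_strictMonoOn_of_tendsto hmono hlim hr0) hneg
  · have h := le_mul_exp_of_deriv_le (div_pos hρ1 hβ0)
      (fun x hx => (hwd x hx).differentiableAt.hasDerivAt) (fun x hx => (hderiv x hx).2) hlim hr0
    calc f r = r ^ (α / β) * f r * r ^ (-(α / β)) := hf_eq
      _ ≤ η * exp (C3 * η ^ (m - 1) / ρ1 * r ^ (ρ1 / β)) * r ^ (-(α / β)) :=
        mul_le_mul_of_nonneg_right h hneg.le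
      _ = _ := by ring
end
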